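/- Let (g,c,n) be a v-admissible triplet with g < c and n < c - 1 + g/4. Then B(g,c,n) = n + 1 - (g + 3c)/4. -/

import Mathlib

open SimpleGraph Set

/-- Auxiliary distance on representations of points of the metric graph:
a point is represented by `(u, v, t)` with `u, v` adjacent and `t ∈ [0,1]`,
meaning the point on the edge `[u,v]` at distance `t` from `u`. -/
noncomputable def mgDistAux {V : Type} [Fintype V] [DecidableEq V] (G : SimpleGraph V)
    (p q : V × V × ℝ) : ℝ :=
  min
    (min (if p.1 = q.1 ∧ p.2.1 = q.2.1 then |p.2.2 - q.2.2| else (Fintype.card V : ℝ) + 1)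
         (if p.1 = q.2.1 ∧ p.2.1 = q.1 then |p.2.2 - (1 - q.2.2)| else (Fintype.card V : ℝ) + 1))
    (min (min (p.2.2 + (G.dist p.1 q.1 : ℝ) + q.2.2)
              (p.2.2 + (G.dist p.1 q.2.1 : ℝ) + (1 - q.2.2)))
         (min ((1 - p.2.2) + (G.dist p.2.1 q.1 : ℝ) + q.2.2)
              ((1 - p.2.2) + (G.dist p.2.1 q.2.1 : ℝ) + (1 - q.2.2))))

/-- The points of the metric graph associated to a simple graph `G`:
the vertices together with the interior points of the edges. -/
def MGPoint {V : Type} (G : SimpleGraph V) : Type :=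
  {p : V × V × ℝ // G.Adj p.1 p.2.1 ∧ p.2.2 ∈ Set.Icc (0 : ℝ) 1}

/-- The shortest-path distance on the metric graph associated to `G`
(every edge has length 1). -/
noncomputable def mgDist {V : Type} [Fintype V] [DecidableEq V] (G : SimpleGraph V)
    (p q : MGPoint G) : ℝ := mgDistAux G p.1 q.1

/-- Distance from a vertex `v` to a point of the metric graph. -/
noncomputable def mgVDist {V : Type} [Fintype V] [DecidableEq V] (G : SimpleGraph V)
    (v : V) (x : MGPoint G) : ℝ :=
  min ((G.dist v x.1.1 : ℝ) + x.1.2.2) ((G.dist v x.1.2.1 : ℝ) + (1 - x.1.2.2))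

/-- `γ` restricted to `[a,b]` is a geodesic in the metric graph of `G`
(an arc-length parametrization realizing distances). -/
def IsMGGeodesic {V : Type} [Fintype V] [DecidableEq V] (G : SimpleGraph V)
    (a b : ℝ) (γ : ℝ → MGPoint G) : Prop :=
  a ≤ b ∧ ∀ s ∈ Set.Icc a b, ∀ t ∈ Set.Icc a b, mgDist G (γ s) (γ t) = |s - t|

/-- A geodesic triangle in the metric graph of `G`: three geodesic sides whose
endpoints match cyclically (distance `0` means equality of points). -/
structure MGTriangle {V : Type} [Fintype V] [DecidableEq V] (G : SimpleGraph V) where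
  a1 : ℝ
  b1 : ℝ
  a2 : ℝ
  b2 : ℝ
  a3 : ℝ
  b3 : ℝ
  g1 : ℝ → MGPoint G
  g2 : ℝ → MGPoint G
  g3 : ℝ → MGPoint G
  h1 : IsMGGeodesic G a1 b1 g1
  h2 : IsMGGeodesic G a2 b2 g2
  h3 : IsMGGeodesic G a3 b3 g3
  glue1 : mgDist G (g1 b1) (g2 a2) = 0
  glue2 : mgDist G (g2 b2) (g3 a3) = 0
  glue3 : mgDist G (g3 b3) (g1 a1) = 0

/-- The sharp thin constant `δ(T)` of a geodesic triangle: the infimum of the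
`d ≥ 0` such that each side is contained in the `d`-neighborhood of the union of
the other two sides. -/
noncomputable def triangleDelta {V : Type} [Fintype V] [DecidableEq V] {G : SimpleGraph V}
    (T : MGTriangle G) : ℝ :=
  sInf {d : ℝ | 0 ≤ d ∧
    (∀ s ∈ Set.Icc T.a1 T.b1,
      (∃ t ∈ Set.Icc T.a2 T.b2, mgDist G (T.g1 s) (T.g2 t) ≤ d) ∨
      (∃ t ∈ Set.Icc T.a3 T.b3, mgDist G (T.g1 s) (T.g3 t) ≤ d)) ∧
    (∀ s ∈ Set.Icc T.a2 T.b2,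
      (∃ t ∈ Set.Icc T.a1 T.b1, mgDist G (T.g2 s) (T.g1 t) ≤ d) ∨
      (∃ t ∈ Set.Icc T.a3 T.b3, mgDist G (T.g2 s) (T.g3 t) ≤ d)) ∧
    (∀ s ∈ Set.Icc T.a3 T.b3,
      (∃ t ∈ Set.Icc T.a1 T.b1, mgDist G (T.g3 s) (T.g1 t) ≤ d) ∨
      (∃ t ∈ Set.Icc T.a2 T.b2, mgDist G (T.g3 s) (T.g2 t) ≤ d))}

/-- The hyperbolicity constant `δ(G)`: the supremum of `δ(T)` over all geodesic
triangles `T` in the metric graph of `G`. -/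
noncomputable def hypDelta {V : Type} [Fintype V] [DecidableEq V] (G : SimpleGraph V) : ℝ :=
  sSup {d : ℝ | ∃ T : MGTriangle G, d = triangleDelta T}

/-- The circumference of `G`: the length of a longest cycle. -/
noncomputable def circumference {V : Type} (G : SimpleGraph V) : ℕ :=
  sSup {n : ℕ | ∃ (a : V) (w : G.Walk a a), w.IsCycle ∧ w.length = n}

/-- `G` belongs to the class `𝒢(g,c,n)` of (connected) graphs with girth `g`,
circumference `c` and `n` vertices (vertex set `Fin n`). -/
def memGclass (g c : ℕ) {n : ℕ} (G : SimpleGraph (Fin n)) : Prop :=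
  G.Connected ∧ G.girth = g ∧ circumference G = c

/-- `A(g,c,n) = min {δ(G) : G ∈ 𝒢(g,c,n)}`. -/
noncomputable def Agcn (g c n : ℕ) : ℝ :=
  sInf {d : ℝ | ∃ G : SimpleGraph (Fin n), memGclass g c G ∧ d = hypDelta G}

/-- `B(g,c,n) = max {δ(G) : G ∈ 𝒢(g,c,n)}`. -/
noncomputable def Bgcn (g c n : ℕ) : ℝ :=
  sSup {d : ℝ | ∃ G : SimpleGraph (Fin n), memGclass g c G ∧ d = hypDelta G}

/-- `G` belongs to the class `ℋ(g,c,m)` of (connected) graphs with girth `g`,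
circumference `c` and `m` edges. -/
def memHclass (g c m : ℕ) {k : ℕ} (G : SimpleGraph (Fin k)) : Prop :=
  G.Connected ∧ G.girth = g ∧ circumference G = c ∧ G.edgeSet.ncard = m

/-- `α(g,c,m) = min {δ(G) : G ∈ ℋ(g,c,m)}`. -/
noncomputable def alphagcm (g c m : ℕ) : ℝ :=
  sInf {d : ℝ | ∃ (k : ℕ) (G : SimpleGraph (Fin k)), memHclass g c m G ∧ d = hypDelta G}

/-- `β(g,c,m) = max {δ(G) : G ∈ ℋ(g,c,m)}`. -/
noncomputable def betagcm (g c m : ℕ) : ℝ :=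
  sSup {d : ℝ | ∃ (k : ℕ) (G : SimpleGraph (Fin k)), memHclass g c m G ∧ d = hypDelta G}


/-- A cyclic vertex sequence of length `L` (a parametrised cycle). -/
structure CycF {V : Type} (G : SimpleGraph V) (L : ℕ) (z : ℕ → V) : Prop where
  three : 3 ≤ L
  adj : ∀ i, G.Adj (z i) (z (i + 1))
  per : ∀ i, z (i + L) = z i
  inj : ∀ i j, i < L → j < L → z i = z j → i = j

/-- The edges of a parametrised cycle. -/
def cEdges {V : Type} [DecidableEq V] (z : ℕ → V) (L : ℕ) : Finset (Sym2 V) :=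
  (Finset.range L).image (fun i => s(z i, z (i + 1)))

section basics

variable {V : Type} {G : SimpleGraph V}

lemma walk_of_fun (f : ℕ → V) (n : ℕ) (h : ∀ i < n, G.Adj (f i) (f (i + 1))) :
    ∃ w : G.Walk (f 0) (f n), w.length = n ∧ w.support = (List.range (n + 1)).map f ∧
      w.edges = (List.range n).map (fun i => s(f i, f (i + 1))) := by
  induction n with
  | zero => exact ⟨Walk.nil, by simp⟩
  | succ n ih =>
    obtain ⟨w, h1, h2, h3⟩ := ih (fun i hi => h i (by omega))
    refine ⟨w.concat (h n (by omega)), by simp [h1], ?_, ?_⟩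
    · rw [Walk.support_concat, h2, List.range_succ (n := n + 1)]; simp
    · rw [Walk.edges_concat, h3, List.range_succ (n := n)]; simp

lemma CycF.mod {L : ℕ} {z : ℕ → V} (h : CycF G L z) (i : ℕ) : z (i % L) = z i := by
  have h3 := h.three
  induction i using Nat.strong_induction_on with
  | _ i ih =>
    by_cases hi : i < L
    · rw [Nat.mod_eq_of_lt hi]
    · have := ih (i - L) (by omega)
      rw [← Nat.mod_eq_sub_mod (by omega)] at this
      rw [this]
      have h2 := h.per (i - L)
      rw [Nat.sub_add_cancel (by omega)] at h2
      exact h2.symm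

lemma CycF.eq_iff {L : ℕ} {z : ℕ → V} (h : CycF G L z) (i j : ℕ) :
    z i = z j ↔ i ≡ j [MOD L] := by
  have h3 := h.three
  constructor
  · intro e
    rw [← h.mod i, ← h.mod j] at e
    exact h.inj _ _ (Nat.mod_lt _ (by omega)) (Nat.mod_lt _ (by omega)) e
  · intro e
    rw [← h.mod i, ← h.mod j, e]

lemma CycF.cycle {L : ℕ} {z : ℕ → V} (h : CycF G L z) :
    ∃ (a : V) (w : G.Walk a a), w.IsCycle ∧ w.length = L := by
  have h3 := h.three
  obtain ⟨w, h1, h2, h4⟩ := walk_of_fun (G := G) z L (fun i _ => h.adj i)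
  have e : z L = z 0 := by simpa using h.per 0
  refine ⟨z 0, w.copy rfl e, ?_, by simp [h1]⟩
  have hne : w.copy rfl e ≠ Walk.nil := by
    intro hh
    have := congrArg Walk.length hh
    simp [h1] at this
    omega
  rw [Walk.isCycle_def, Walk.isTrail_def]
  refine ⟨?_, hne, ?_⟩
  · rw [Walk.edges_copy, h4]
    refine List.Nodup.map_on ?_ List.nodup_range
    intro i hi j hj hij
    simp only [List.mem_range] at hi hj
    rw [Sym2.eq_iff] at hij
    rcases hij with ⟨e1, _⟩ | ⟨e1, e2⟩
    · exact h.inj _ _ hi hj e1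
    · rw [h.eq_iff] at e1 e2
      exfalso
      have e3 : i + 2 ≡ i [MOD L] := (Nat.ModEq.add_right 1 e2).trans e1.symm
      have e4 : 2 ≡ 0 [MOD L] := Nat.ModEq.add_left_cancel' i (by simpa using e3)
      have := (Nat.modEq_zero_iff_dvd.mp e4)
      have := Nat.le_of_dvd (by norm_num) this
      omega
  · rw [Walk.support_copy, h2, List.range_succ_eq_map, List.map_cons, List.tail_cons, List.map_map]
    refine List.Nodup.map_on ?_ List.nodup_range
    intro i hi j hj hij
    simp only [List.mem_range] at hi hj
    simp only [Function.comp] at hij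
    rw [h.eq_iff] at hij
    have := Nat.ModEq.add_right_cancel' 1 hij
    have h5 := Nat.mod_eq_of_lt hi
    have h6 := Nat.mod_eq_of_lt hj
    unfold Nat.ModEq at this
    omega

lemma exists_CycF {a : V} (w : G.Walk a a) (hw : w.IsCycle) :
    ∃ z, CycF G w.length z := by
  have h3 := hw.three_le_length
  refine ⟨fun i => w.getVert (i % w.length), h3, ?_, ?_, ?_⟩
  · intro i
    have hlt := Nat.mod_lt i (show 0 < w.length by omega)
    have hadj := w.adj_getVert_succ hlt
    by_cases hi : i % w.length + 1 = w.length
    · have : (i + 1) % w.length = 0 := by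
        rw [Nat.add_mod, Nat.mod_eq_of_lt (show 1 < w.length by omega), hi, Nat.mod_self]
      rw [hi] at hadj
      simp only [this]
      simpa using hadj
    · have : (i + 1) % w.length = i % w.length + 1 := by
        rw [Nat.add_mod, Nat.mod_eq_of_lt (show 1 < w.length by omega)]
        exact Nat.mod_eq_of_lt (by omega)
      simp only [this]
      exact hadj
  · intro i; simp
  · intro i j hi hj hij
    simp only [Nat.mod_eq_of_lt hi, Nat.mod_eq_of_lt hj] at hij
    exact hw.getVert_injOn' (by simp; omega) (by simp; omega) hij

variable [DecidableEq V]

lemma CycF.mem_edges {L : ℕ} {z : ℕ → V} (h : CycF G L z) (v w : V) :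
    s(v, w) ∈ cEdges z L ↔ ∃ i, (v = z i ∧ w = z (i + 1)) ∨ (v = z (i + 1) ∧ w = z i) := by
  have h3 := h.three
  unfold cEdges
  simp only [Finset.mem_image, Finset.mem_range]
  constructor
  · rintro ⟨i, _, e⟩
    rw [Sym2.eq_iff] at e
    refine ⟨i, ?_⟩
    rcases e with ⟨e1, e2⟩ | ⟨e1, e2⟩
    · left; exact ⟨e1.symm, e2.symm⟩
    · right; exact ⟨e2.symm, e1.symm⟩
  · rintro ⟨i, e⟩
    refine ⟨i % L, Nat.mod_lt _ (by omega), ?_⟩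
    have e1 : z (i % L) = z i := h.mod i
    have e2 : z (i % L + 1) = z (i + 1) := by
      rw [h.eq_iff]; exact Nat.ModEq.add_right 1 (Nat.mod_modEq i L)
    rw [e1, e2, Sym2.eq_iff]
    rcases e with ⟨e1, e2⟩ | ⟨e1, e2⟩
    · left; exact ⟨e1.symm, e2.symm⟩
    · right; exact ⟨e2.symm, e1.symm⟩

lemma CycF.edge_mem {L : ℕ} {z : ℕ → V} (h : CycF G L z) (i : ℕ) :
    s(z i, z (i + 1)) ∈ cEdges z L := (h.mem_edges _ _).2 ⟨i, Or.inl ⟨rfl, rfl⟩⟩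

lemma CycF.edges_sub {L : ℕ} {z : ℕ → V} (h : CycF G L z) :
    ∀ e ∈ cEdges z L, e ∈ G.edgeSet := by
  intro e he
  unfold cEdges at he
  simp only [Finset.mem_image, Finset.mem_range] at he
  obtain ⟨i, _, rfl⟩ := he
  exact h.adj i

lemma CycF.edge_inj {L : ℕ} {z : ℕ → V} (h : CycF G L z) (i j : ℕ) (hi : i < L) (hj : j < L)
    (hij : s(z i, z (i + 1)) = s(z j, z (j + 1))) : i = j := by
  have h3 := h.three
  rw [Sym2.eq_iff] at hij
  rcases hij with ⟨e1, _⟩ | ⟨e1, e2⟩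
  · exact h.inj _ _ hi hj e1
  · rw [h.eq_iff] at e1 e2
    exfalso
    have e3 : i + 2 ≡ i [MOD L] := (Nat.ModEq.add_right 1 e2).trans e1.symm
    have e4 : 2 ≡ 0 [MOD L] := Nat.ModEq.add_left_cancel' i (by simpa using e3)
    have := (Nat.modEq_zero_iff_dvd.mp e4)
    have := Nat.le_of_dvd (by norm_num) this
    omega

lemma CycF.card_edges {L : ℕ} {z : ℕ → V} (h : CycF G L z) : (cEdges z L).card = L := by
  unfold cEdges
  rw [Finset.card_image_of_injOn, Finset.card_range]
  intro i hi j hj hij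
  exact h.edge_inj i j (by simpa using hi) (by simpa using hj) hij

/-- every vertex meets none or exactly two edges of a cycle -/
lemma CycF.two_reg {L : ℕ} {z : ℕ → V} (h : CycF G L z) (v w : V) (hvw : s(v, w) ∈ cEdges z L) :
    ∃ w', w' ≠ w ∧ s(v, w') ∈ cEdges z L ∧ ∀ x, s(v, x) ∈ cEdges z L → x = w ∨ x = w' := by
  have h3 := h.three
  have key : ∀ i, z (i + (L - 1)) ≠ z (i + 1) ∧ s(z i, z (i + (L - 1))) ∈ cEdges z L ∧
      ∀ x, s(z i, x) ∈ cEdges z L → x = z (i + 1) ∨ x = z (i + (L - 1)) := by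
    intro i
    refine ⟨?_, ?_, ?_⟩
    · intro e
      rw [h.eq_iff] at e
      have e1 := Nat.ModEq.add_left_cancel' i e
      unfold Nat.ModEq at e1
      rw [Nat.mod_eq_of_lt (by omega), Nat.mod_eq_of_lt (by omega)] at e1
      omega
    · rw [h.mem_edges]
      refine ⟨i + (L - 1), Or.inr ⟨?_, rfl⟩⟩
      have : i + (L - 1) + 1 = i + L := by omega
      rw [this, h.per]
    · intro x hx
      rw [h.mem_edges] at hx
      obtain ⟨j, ⟨e1, e2⟩ | ⟨e1, e2⟩⟩ := hx
      · left
        rw [e2, h.eq_iff]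
        rw [h.eq_iff] at e1
        exact Nat.ModEq.add_right 1 e1.symm
      · right
        rw [e2, h.eq_iff]
        rw [h.eq_iff] at e1
        have := Nat.ModEq.add_right (L - 1) e1
        have e3 : j + 1 + (L - 1) = j + L := by omega
        rw [e3] at this
        exact (Nat.add_modEq_right (a := j) (n := L)).symm.trans this.symm
  rcases (h.mem_edges _ _).1 hvw with ⟨i, ⟨e1, e2⟩ | ⟨e1, e2⟩⟩
  · subst e1 e2
    obtain ⟨k1, k2, k3⟩ := key i
    exact ⟨_, k1, k2, k3⟩
  · subst e1 e2
    obtain ⟨k1, k2, k3⟩ := key (i + 1)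
    have e : z (i + 1 + (L - 1)) = z i := by
      have : i + 1 + (L - 1) = i + L := by omega
      rw [this, h.per]
    rw [e] at k1 k2 k3
    exact ⟨_, k1.symm, h.edge_mem _, fun x hx => (k3 x hx).symm⟩

/-- a non-acyclic set of edges has at least `girth` many edges -/
lemma girth_le_card [Fintype V] (F : Finset (Sym2 V)) (hF : ∀ e ∈ F, e ∈ G.edgeSet)
    (hna : ¬ (SimpleGraph.fromEdgeSet (F : Set (Sym2 V))).IsAcyclic) : G.girth ≤ F.card := by
  unfold IsAcyclic at hna
  push Not at hna
  obtain ⟨v, w, hw⟩ := hna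
  have hle : SimpleGraph.fromEdgeSet (F : Set (Sym2 V)) ≤ G := by
    intro a b hab
    rw [fromEdgeSet_adj] at hab
    exact hF _ hab.1
  have h1 := girth_le_length (hw.mapLe hle)
  simp only [Walk.length_map, Walk.mapLe] at h1
  refine h1.trans ?_
  rw [← Walk.length_edges, ← List.toFinset_card_of_nodup hw.edges_nodup]
  apply Finset.card_le_card
  intro e he
  rw [List.mem_toFinset] at he
  have := w.edges_subset_edgeSet he
  rw [edgeSet_fromEdgeSet] at this
  exact this.1

lemma girth_le_of_two_paths [Fintype V] {u v : V} (p q : G.Walk u v) (hp : p.IsPath) (hq : q.IsPath)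
    (hne : p ≠ q) : G.girth ≤ p.length + q.length := by
  have h := girth_le_card (G := G) (p.edges.toFinset ∪ q.edges.toFinset) ?_ ?_
  · refine h.trans ((Finset.card_union_le _ _).trans ?_)
    gcongr
    · rw [← Walk.length_edges]; exact List.toFinset_card_le _
    · rw [← Walk.length_edges]; exact List.toFinset_card_le _
  · intro e he
    simp only [Finset.mem_union, List.mem_toFinset] at he
    rcases he with he | he
    · exact p.edges_subset_edgeSet he
    · exact q.edges_subset_edgeSet he
  · intro hac
    set H := SimpleGraph.fromEdgeSet ((p.edges.toFinset ∪ q.edges.toFinset : Finset (Sym2 V)) : Set (Sym2 V)) with hH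
    have hp1 : ∀ e ∈ p.edges, e ∈ H.edgeSet := by
      intro e he
      rw [hH, edgeSet_fromEdgeSet]
      refine ⟨by simp [he], ?_⟩
      exact G.not_isDiag_of_mem_edgeSet (p.edges_subset_edgeSet he)
    have hq1 : ∀ e ∈ q.edges, e ∈ H.edgeSet := by
      intro e he
      rw [hH, edgeSet_fromEdgeSet]
      refine ⟨by simp [he], ?_⟩
      exact G.not_isDiag_of_mem_edgeSet (q.edges_subset_edgeSet he)
    have := hac.path_unique ⟨p.transfer H hp1, hp.transfer hp1⟩ ⟨q.transfer H hq1, hq.transfer hq1⟩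
    have h2 : p.transfer H hp1 = q.transfer H hq1 := congrArg Subtype.val this
    apply hne
    have hs := congrArg Walk.support h2
    simp only [Walk.support_transfer] at hs
    exact Walk.ext_support hs

lemma not_acyclic_of_even [Fintype V] (H : SimpleGraph V) (a b : V) (hab : H.Adj a b)
    (h2 : ∀ v w, H.Adj v w → ∃ w', w' ≠ w ∧ H.Adj v w') : ¬ H.IsAcyclic := by
  intro hac
  have hex : ∀ n : ℕ, ∃ u v, ∃ p : H.Walk u v, p.IsPath ∧ p.length = n + 1 := by
    intro n
    induction n with
    | zero => exact ⟨a, b, Walk.cons hab Walk.nil, by simp [hab.ne], rfl⟩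
    | succ n ih =>
      obtain ⟨u, v, p, hp, hl⟩ := ih
      have hnn : ¬ p.Nil := by rw [Walk.nil_iff_length_eq]; omega
      have hadj := p.adj_penultimate hnn
      obtain ⟨w', hw1, hw2⟩ := h2 _ _ hadj.symm
      refine ⟨u, w', p.concat hw2, ?_, by simp [hl]⟩
      apply hp.concat
      intro hmem
      exact hw1 (hac.eq_penultimate_of_adj_end hp hw2 hmem)
  obtain ⟨u, v, p, hp, hl⟩ := hex (Fintype.card V)
  have := hp.length_lt
  omega

/-- the symmetric difference of two cycles is not acyclic -/
lemma girth_le_symmDiff [Fintype V] {L M : ℕ} {z y : ℕ → V} (hz : CycF G L z) (hy : CycF G M y)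
    (hne : L ≠ M) :
    G.girth + 2 * (cEdges z L ∩ cEdges y M).card ≤ L + M := by
  set A := cEdges z L with hA
  set B := cEdges y M with hB
  have hcA : A.card = L := hz.card_edges
  have hcB : B.card = M := hy.card_edges
  have h := girth_le_card (G := G) ((A \ B) ∪ (B \ A)) ?_ ?_
  · have h1 := Finset.card_union_le (A \ B) (B \ A)
    have h2 := Finset.card_sdiff_add_card_inter A B
    have h3 := Finset.card_sdiff_add_card_inter B A
    rw [Finset.inter_comm B A] at h3
    omega
  · intro e he
    simp only [Finset.mem_union, Finset.mem_sdiff] at he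
    rcases he with he | he
    · exact hz.edges_sub e he.1
    · exact hy.edges_sub e he.1
  · have hadj : ∀ v w, (SimpleGraph.fromEdgeSet (((A \ B) ∪ (B \ A) : Finset (Sym2 V)) : Set (Sym2 V))).Adj v w ↔
        ((s(v, w) ∈ A ∧ s(v, w) ∉ B) ∨ (s(v, w) ∈ B ∧ s(v, w) ∉ A)) := by
      intro v w
      rw [fromEdgeSet_adj]
      simp only [Finset.coe_union, Finset.coe_sdiff, Set.mem_union, Set.mem_diff, Finset.mem_coe]
      constructor
      · exact fun h => h.1
      · intro h
        refine ⟨h, ?_⟩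
        rcases h with h | h
        · exact (show G.Adj v w from hz.edges_sub _ h.1).ne
        · exact (show G.Adj v w from hy.edges_sub _ h.1).ne
    have hnonempty : ((A \ B) ∪ (B \ A)).Nonempty := by
      by_contra hcon
      rw [Finset.not_nonempty_iff_eq_empty, Finset.union_eq_empty, Finset.sdiff_eq_empty_iff_subset,
        Finset.sdiff_eq_empty_iff_subset] at hcon
      have := Finset.Subset.antisymm hcon.1 hcon.2
      rw [this] at hcA
      omega
    obtain ⟨e, he⟩ := hnonempty
    induction e using Sym2.ind with
    | _ a b =>
      refine not_acyclic_of_even _ a b ((hadj a b).2 (by simpa using he)) ?_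
      have main : ∀ (A B : Finset (Sym2 V)),
        (∀ v w, s(v, w) ∈ A → ∃ w', w' ≠ w ∧ s(v, w') ∈ A ∧ ∀ x, s(v, x) ∈ A → x = w ∨ x = w') →
        (∀ v w, s(v, w) ∈ B → ∃ w', w' ≠ w ∧ s(v, w') ∈ B ∧ ∀ x, s(v, x) ∈ B → x = w ∨ x = w') →
        ∀ v w, s(v, w) ∈ A → s(v, w) ∉ B → ∃ w', w' ≠ w ∧
          ((s(v, w') ∈ A ∧ s(v, w') ∉ B) ∨ (s(v, w') ∈ B ∧ s(v, w') ∉ A)) := by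
        intro A B hA hB v w h1 h2
        obtain ⟨w', k1, k2, k3⟩ := hA v w h1
        by_cases hb : s(v, w') ∈ B
        · obtain ⟨w'', l1, l2, l3⟩ := hB v w' hb
          refine ⟨w'', ?_, Or.inr ⟨l2, ?_⟩⟩
          · rintro rfl; exact h2 l2
          · intro h
            rcases k3 _ h with rfl | rfl
            · exact h2 l2
            · exact l1 rfl
        · exact ⟨w', k1, Or.inl ⟨k2, hb⟩⟩
      intro v w hvw
      rw [hadj] at hvw
      rcases hvw with ⟨h1, h2⟩ | ⟨h1, h2⟩
      · obtain ⟨w', e1, e2⟩ := main A B hz.two_reg hy.two_reg v w h1 h2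
        exact ⟨w', e1, (hadj _ _).2 e2⟩
      · obtain ⟨w', e1, e2⟩ := main B A hy.two_reg hz.two_reg v w h1 h2
        exact ⟨w', e1, (hadj _ _).2 e2.symm⟩

end basics


/-- a path between two vertices that uses an edge not on the cycle `z` -/
def Ear {V : Type} [DecidableEq V] (G : SimpleGraph V) (z : ℕ → V) (L : ℕ) (u v : V) (r : ℕ) : Prop :=
  ∃ p : G.Walk u v, p.IsPath ∧ p.length = r ∧ ∃ e ∈ p.edges, e ∉ cEdges z L

/-- The combinatorial configuration extracted from a fat geodesic triangle. -/
structure Config {V : Type} (G : SimpleGraph V) (L k : ℕ) (z : ℕ → V) (x d : ℝ) : Prop where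
  cyc : CycF G L z
  k2 : 2 ≤ k
  kL : k ≤ L
  lo0 : 0 < x - d
  lo1 : x - d < 1
  hi0 : (k : ℝ) - 1 < x + d
  hi1 : x + d < k
  dAA : ∀ i j : ℕ, 1 ≤ i → i ≤ j → j < k → (j : ℝ) - i ≤ G.dist (z i) (z j)
  d0 : ∀ i : ℕ, 1 ≤ i → i < k → (i : ℝ) - 2 * (x - d) ≤ G.dist (z 0) (z i)
  dk : ∀ i : ℕ, 1 ≤ i → i < k → 2 * (x + d) - i - k ≤ G.dist (z k) (z i)
  d0k : 4 * d - k ≤ G.dist (z 0) (z k)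
  dAB : ∀ t i : ℕ, k ≤ t → t ≤ L → 1 ≤ i → i < k → d - |(i : ℝ) - x| ≤ G.dist (z t) (z i)

section ears

variable {V : Type} {G : SimpleGraph V}

lemma CycF.dist_le {L : ℕ} {z : ℕ → V} (h : CycF G L z) (i j : ℕ) (hij : i ≤ j) :
    (G.dist (z i) (z j) : ℝ) ≤ (j : ℝ) - i := by
  obtain ⟨w, h1, _⟩ := walk_of_fun (G := G) (fun t => z (i + t)) (j - i) (fun t _ => h.adj _)
  have hw : G.dist (z (i + 0)) (z (i + (j - i))) ≤ j - i := by
    have h2 := SimpleGraph.dist_le w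
    rw [h1] at h2
    exact h2
  simp only [add_zero, Nat.add_sub_cancel' hij] at hw
  have : (G.dist (z i) (z j) : ℝ) ≤ ((j - i : ℕ) : ℝ) := by exact_mod_cast hw
  rwa [Nat.cast_sub hij] at this

variable [DecidableEq V]

lemma Ear.symm {z : ℕ → V} {L : ℕ} {u v : V} {r : ℕ} (h : Ear G z L u v r) : Ear G z L v u r := by
  obtain ⟨p, h1, h2, e, h3, h4⟩ := h
  exact ⟨p.reverse, h1.reverse, by simp [h2], e, by simpa using h3, h4⟩

lemma Ear.dist_le {z : ℕ → V} {L : ℕ} {u v : V} {r : ℕ} (h : Ear G z L u v r) :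
    (G.dist u v : ℝ) ≤ r := by
  obtain ⟨p, h1, h2, e, h3, h4⟩ := h
  have := SimpleGraph.dist_le p
  rw [h2] at this
  exact_mod_cast this

lemma ear_arc [Fintype V] {z : ℕ → V} {L : ℕ} (hz : CycF G L z) {i j r : ℕ}
    (h : Ear G z L (z i) (z j) r) (hij : i ≤ j) (hj : j < i + L) :
    (G.girth : ℝ) ≤ (j : ℝ) - i + r := by
  obtain ⟨p, h1, h2, e, h3, h4⟩ := h
  obtain ⟨w, k1, k2, k3⟩ := walk_of_fun (G := G) (fun t => z (i + t)) (j - i) (fun t _ => hz.adj _)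
  have ej : i + (j - i) = j := by omega
  have hw : (w.copy (by simp) (by rw [ej]) : G.Walk (z i) (z j)).IsPath := by
    rw [Walk.isPath_def, Walk.support_copy, k2]
    refine List.Nodup.map_on ?_ List.nodup_range
    intro s hs t ht hst
    simp only [List.mem_range] at hs ht
    rw [hz.eq_iff] at hst
    have := Nat.ModEq.add_left_cancel' i hst
    unfold Nat.ModEq at this
    rwa [Nat.mod_eq_of_lt (by omega), Nat.mod_eq_of_lt (by omega)] at this
  have := girth_le_of_two_paths (w.copy (by simp) (by rw [ej]) : G.Walk (z i) (z j)) p hw h1 ?_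
  · rw [h2, Walk.length_copy, k1] at this
    have h5 : (G.girth : ℝ) ≤ ((j - i + r : ℕ) : ℝ) := by exact_mod_cast this
    rw [Nat.cast_add, Nat.cast_sub hij] at h5
    exact h5
  · intro he
    rw [← he, Walk.edges_copy, k3] at h3
    simp only [List.mem_map, List.mem_range] at h3
    obtain ⟨t, _, rfl⟩ := h3
    exact h4 (hz.edge_mem _)

lemma Config.key [Fintype V] {L k : ℕ} {z : ℕ → V} {x d : ℝ} (hc : Config G L k z x d)
    (hG : G.Connected) {i j r : ℕ} (h : Ear G z L (z i) (z j) r) (hi : 1 ≤ i) (hiL : i ≤ L)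
    (hj : 1 ≤ j) (hjL : j ≤ L) :
    (i < k ∧ j < k ∧ G.girth ≤ 2 * r) ∨
    (k ≤ i ∧ k ≤ j ∧ 4 * d + G.girth ≤ L + 2 * r) ∨
    ((i < k ↔ k ≤ j) ∧ 4 * d + G.girth ≤ L + 4 * r) := by
  have hz := hc.cyc
  have h3 := hz.three
  have z0 : z L = z 0 := by simpa using hz.per 0
  -- both orders
  have AA : ∀ i j : ℕ, 1 ≤ i → i ≤ j → j < k → Ear G z L (z i) (z j) r → G.girth ≤ 2 * r := by
    intro i j hi hij hj h
    have e1 := ear_arc hz h hij (by have := hc.kL; omega)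
    have e2 := h.dist_le
    have e3 := hc.dAA i j hi hij hj
    have : (G.girth : ℝ) ≤ 2 * r := by linarith
    exact_mod_cast this
  have BB : ∀ i j : ℕ, k ≤ i → i ≤ j → j ≤ L → Ear G z L (z i) (z j) r →
      4 * d + G.girth ≤ L + 2 * r := by
    intro i j hi hij hj h
    have e1 := ear_arc hz h hij (by have := hc.k2; omega)
    have e2 := h.symm.dist_le
    have e3 := hc.d0k
    have e4 := hz.dist_le j L hj
    have e5 := hz.dist_le k i hi
    rw [SimpleGraph.dist_comm, z0] at e4
    rw [SimpleGraph.dist_comm] at e5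
    have t1 : (G.dist (z 0) (z k) : ℝ) ≤ G.dist (z 0) (z j) + G.dist (z j) (z k) := by
      exact_mod_cast hG.dist_triangle
    have t2 : (G.dist (z j) (z k) : ℝ) ≤ G.dist (z j) (z i) + G.dist (z i) (z k) := by
      exact_mod_cast hG.dist_triangle
    linarith
  have AB : ∀ i t : ℕ, 1 ≤ i → i < k → k ≤ t → t ≤ L → Ear G z L (z i) (z t) r →
      4 * d + G.girth ≤ L + 4 * r := by
    intro i t hi hik ht htL h
    have e1 := ear_arc hz h (by omega) (by omega)
    have h' : Ear G z L (z t) (z (i + L)) r := by rw [hz.per]; exact h.symm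
    have e2 := ear_arc hz h' (by omega) (by omega)
    have e3 := h.symm.dist_le
    have e4 := hc.dAB t i ht htL hi hik
    have e5 := hc.d0 i hi hik
    have e6 := hc.dk i hi hik
    have e7 := hz.dist_le t L htL
    have e8 := hz.dist_le k t ht
    rw [SimpleGraph.dist_comm, z0] at e7
    push_cast at e2
    have t1 : (G.dist (z 0) (z i) : ℝ) ≤ G.dist (z 0) (z t) + G.dist (z t) (z i) := by
      exact_mod_cast hG.dist_triangle
    have t2 : (G.dist (z k) (z i) : ℝ) ≤ G.dist (z k) (z t) + G.dist (z t) (z i) := by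
      exact_mod_cast hG.dist_triangle
    rcases abs_cases ((i : ℝ) - x) with ⟨e9, e10⟩ | ⟨e9, e10⟩
    · rw [e9] at e4; linarith
    · rw [e9] at e4; linarith
  by_cases h1 : i < k
  · by_cases h2 : j < k
    · left
      refine ⟨h1, h2, ?_⟩
      rcases le_total i j with hij | hij
      · exact AA i j hi hij h2 h
      · exact AA j i hj hij h1 h.symm
    · right; right
      exact ⟨by omega, AB i j hi h1 (by omega) hjL h⟩
  · by_cases h2 : j < k
    · right; right
      exact ⟨by omega, AB j i hj h2 (by omega) hiL h.symm⟩
    · right; left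
      refine ⟨by omega, by omega, ?_⟩
      rcases le_total i j with hij | hij
      · exact BB i j (by omega) hij hjL h
      · exact BB j i (by omega) hij hiL h.symm

end ears

/-- first return time of the sequence `y` to the set `S` after time `i` -/
noncomputable def ret {V : Type} (y : ℕ → V) (S : Set V) (i : ℕ) : ℕ :=
  sInf {r : ℕ | 1 ≤ r ∧ y (i + r) ∈ S}

section ret

variable {V : Type} {G : SimpleGraph V} {M : ℕ} {y : ℕ → V} {S : Set V}

lemma ret_spec (hy : CycF G M y) {i : ℕ} (hi : y i ∈ S) :
    1 ≤ ret y S i ∧ y (i + ret y S i) ∈ S ∧ (∀ o, 1 ≤ o → o < ret y S i → y (i + o) ∉ S) := by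
  have h3 := hy.three
  have hne : {r : ℕ | 1 ≤ r ∧ y (i + r) ∈ S}.Nonempty := ⟨M, by omega, by rw [hy.per]; exact hi⟩
  have := Nat.sInf_mem hne
  refine ⟨this.1, this.2, fun o ho h1 h2 => ?_⟩
  exact Nat.notMem_of_lt_sInf h1 ⟨ho, h2⟩

lemma ret_inj (hy : CycF G M y) {i i' o o' : ℕ} (hiM : i < M) (hiM' : i' < M)
    (hi : y i ∈ S) (hi' : y i' ∈ S) (ho : 1 ≤ o) (hor : o ≤ ret y S i)
    (ho' : 1 ≤ o') (hor' : o' ≤ ret y S i') (h : i + o ≡ i' + o' [MOD M]) : i = i' ∧ o = o' := by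
  have main : ∀ {i i' o o' : ℕ}, i < M → i' < M → y i ∈ S → y i' ∈ S → 1 ≤ o → o ≤ o' →
      o' ≤ ret y S i' → i + o ≡ i' + o' [MOD M] → i = i' ∧ o = o' := by
    intro i i' o o' hiM hiM' hi hi' ho hoo hor' h
    have e : i ≡ i' + (o' - o) [MOD M] := by
      apply Nat.ModEq.add_right_cancel' o
      have : i' + (o' - o) + o = i' + o' := by omega
      rw [this]; exact h
    have e2 : y i = y (i' + (o' - o)) := (hy.eq_iff _ _).2 e
    have e3 : o' - o = 0 := by
      by_contra hne
      exact (ret_spec hy hi').2.2 (o' - o) (by omega) (by omega) (e2 ▸ hi)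
    rw [e3, add_zero] at e2
    exact ⟨hy.inj _ _ hiM hiM' e2, by omega⟩
  rcases le_total o o' with hoo | hoo
  · exact main hiM hiM' hi hi' ho hoo hor' h
  · have := main hiM' hiM hi' hi ho' hoo hor h.symm
    exact ⟨this.1.symm, this.2.symm⟩

open Classical in
lemma sum_ret (hy : CycF G M y) :
    ∑ i ∈ (Finset.range M).filter (fun i => y i ∈ S), ret y S i ≤ M := by
  have h3 := hy.three
  set I := (Finset.range M).filter (fun i => y i ∈ S) with hI
  have h1 : (I.sigma (fun i => Finset.Icc 1 (ret y S i))).card = ∑ i ∈ I, ret y S i := by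
    rw [Finset.card_sigma]; simp
  rw [← h1]
  conv_rhs => rw [← Finset.card_range M]
  apply Finset.card_le_card_of_injOn (fun p => (p.1 + p.2) % M)
  · intro p _
    simp only [Finset.coe_range, Set.mem_Iio]
    exact Nat.mod_lt _ (by omega)
  · rintro ⟨i, o⟩ hp ⟨i', o'⟩ hp' heq
    simp only [hI, Finset.coe_sigma, Set.mem_sigma_iff, Finset.mem_coe, Finset.mem_filter,
      Finset.mem_range, Finset.mem_Icc] at hp hp'
    obtain ⟨e1, e2⟩ := ret_inj hy hp.1.1 hp'.1.1 hp.1.2 hp'.1.2 hp.2.1 hp.2.2 hp'.2.1 hp'.2.2 heq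
    subst e1 e2
    rfl

end ret

section count
variable {V : Type} {G : SimpleGraph V} [Fintype V] [DecidableEq V]

open Classical in
lemma in_count {L M : ℕ} {z y : ℕ → V} (hz : CycF G L z) (hy : CycF G M y) :
    M + L ≤ ((Finset.range M).filter (fun i => y i ∈ Set.range z)).card + Fintype.card V := by
  set I := (Finset.range M).filter (fun i => y i ∈ Set.range z)
  have h1 : ((Finset.range M).image y).card = M := by
    rw [Finset.card_image_of_injOn, Finset.card_range]
    intro i hi j hj h
    exact hy.inj i j (by simpa using hi) (by simpa using hj) h
  have h2 : ((Finset.range L).image z).card = L := by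
    rw [Finset.card_image_of_injOn, Finset.card_range]
    intro i hi j hj h
    exact hz.inj i j (by simpa using hi) (by simpa using hj) h
  have h3 := Finset.card_union_add_card_inter ((Finset.range M).image y) ((Finset.range L).image z)
  have h4 : ((Finset.range M).image y ∩ (Finset.range L).image z).card ≤ I.card := by
    refine le_trans (Finset.card_le_card ?_) (Finset.card_image_le (f := y) (s := I))
    intro v hv
    simp only [Finset.mem_inter, Finset.mem_image, Finset.mem_range] at hv
    obtain ⟨⟨i, hi, rfl⟩, ⟨j, _, hj⟩⟩ := hv
    simp only [I, Finset.mem_image, Finset.mem_filter, Finset.mem_range]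
    exact ⟨i, ⟨hi, ⟨j, hj⟩⟩, rfl⟩
  have h5 := Finset.card_le_univ ((Finset.range M).image y ∪ (Finset.range L).image z)
  omega

lemma seg_ear {L M : ℕ} {z y : ℕ → V} (hz : CycF G L z) (hy : CycF G M y) {i : ℕ}
    (hi : y i ∈ Set.range z) (hr : ret y (Set.range z) i < M)
    (hne : ¬ (ret y (Set.range z) i = 1 ∧ s(y i, y (i + 1)) ∈ cEdges z L)) :
    Ear G z L (y i) (y (i + ret y (Set.range z) i)) (ret y (Set.range z) i) := by
  obtain ⟨r1, r2, r3⟩ := ret_spec hy hi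
  obtain ⟨w, k1, k2, k3⟩ := walk_of_fun (G := G) (fun t => y (i + t)) (ret y (Set.range z) i)
    (fun t _ => hy.adj _)
  refine ⟨w, ?_, k1, s(y i, y (i + 1)), ?_, ?_⟩
  · rw [Walk.isPath_def, k2]
    refine List.Nodup.map_on ?_ List.nodup_range
    intro s hs t ht hst
    simp only [List.mem_range] at hs ht
    rw [hy.eq_iff] at hst
    have := Nat.ModEq.add_left_cancel' i hst
    unfold Nat.ModEq at this
    rwa [Nat.mod_eq_of_lt (by omega), Nat.mod_eq_of_lt (by omega)] at this
  · rw [k3]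
    simp only [List.mem_map, List.mem_range]
    exact ⟨0, by omega, by simp⟩
  · intro hmem
    by_cases h1 : ret y (Set.range z) i = 1
    · exact hne ⟨h1, hmem⟩
    · apply r3 1 le_rfl (by omega)
      rw [hz.mem_edges] at hmem
      obtain ⟨j, h | h⟩ := hmem
      · exact ⟨_, h.2.symm⟩
      · exact ⟨_, h.2.symm⟩

lemma CycF.index {L : ℕ} {z : ℕ → V} (hz : CycF G L z) {v : V} (hv : v ∈ Set.range z) :
    ∃ i, 1 ≤ i ∧ i ≤ L ∧ v = z i := by
  obtain ⟨j, rfl⟩ := hv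
  have h3 := hz.three
  have hlt := Nat.mod_lt j (show 0 < L by omega)
  by_cases h : j % L = 0
  · refine ⟨L, by omega, le_rfl, ?_⟩
    rw [← hz.mod j, h]
    simpa using (hz.per 0).symm
  · exact ⟨j % L, by omega, by omega, (hz.mod j).symm⟩

/-- a shorter cycle produces an ear of a longer cycle -/
lemma exists_ear {L M : ℕ} {z y : ℕ → V} (hz : CycF G L z) (hy : CycF G M y) (hML : M < L)
    (hcard : Fintype.card V < L + M - 1) :
    ∃ i j r, Ear G z L (z i) (z j) r ∧ 1 ≤ i ∧ i ≤ L ∧ 1 ≤ j ∧ j ≤ L ∧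
      r + L ≤ Fintype.card V + 1 ∧ 1 ≤ r := by
  classical
  have h3 := hy.three
  have h3' := hz.three
  have hin := in_count hz hy
  have hsum := sum_ret (S := Set.range z) hy
  set I := (Finset.range M).filter (fun i => y i ∈ Set.range z) with hI
  have hmemI : ∀ i, i ∈ I ↔ i < M ∧ y i ∈ Set.range z := by
    intro i; simp [hI]
  have hrle : ∀ i ∈ I, ret y (Set.range z) i + L ≤ Fintype.card V + 1 := by
    intro i hi
    have e1 : ∑ j ∈ I, 1 ≤ ∑ j ∈ I, ret y (Set.range z) j :=
      Finset.sum_le_sum (fun j hj => (ret_spec hy ((hmemI j).1 hj).2).1)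
    have e2 : ∑ j ∈ I.erase i, 1 ≤ ∑ j ∈ I.erase i, ret y (Set.range z) j :=
      Finset.sum_le_sum (fun j hj => (ret_spec hy ((hmemI j).1 (Finset.mem_of_mem_erase hj)).2).1)
    rw [← Finset.add_sum_erase I _ hi] at hsum
    have e3 := Finset.card_erase_of_mem hi
    have e4 : 0 < I.card := Finset.card_pos.2 ⟨i, hi⟩
    simp only [Finset.sum_const, smul_eq_mul, mul_one] at e2
    omega
  by_contra hcon
  push Not at hcon
  have hall : ∀ i ∈ I, ret y (Set.range z) i = 1 ∧ s(y i, y (i + 1)) ∈ cEdges z L := by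
    intro i hi
    by_contra hne
    obtain ⟨hiM, his⟩ := (hmemI i).1 hi
    obtain ⟨r1, r2, r3⟩ := ret_spec hy his
    have hr := hrle i hi
    have hear := seg_ear hz hy his (by omega) hne
    obtain ⟨i1, a1, a2, a3⟩ := hz.index his
    obtain ⟨j1, b1, b2, b3⟩ := hz.index r2
    rw [a3, b3] at hear
    have := hcon _ _ _ hear a1 a2 b1 b2 hr
    omega
  have hE : ∀ i, y i ∈ Set.range z → s(y i, y (i + 1)) ∈ cEdges z L := by
    intro i hi
    have hlt := Nat.mod_lt i (show 0 < M by omega)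
    have := (hall (i % M) ((hmemI _).2 ⟨hlt, by rw [hy.mod]; exact hi⟩)).2
    have e2 : y (i % M + 1) = y (i + 1) := by
      rw [hy.eq_iff]; exact Nat.ModEq.add_right 1 (Nat.mod_modEq i M)
    rwa [hy.mod, e2] at this
  have hI0 : I.Nonempty := by
    rw [← Finset.card_pos]; omega
  obtain ⟨i0, hi0⟩ := hI0
  have hallin : ∀ t, y (i0 + t) ∈ Set.range z := by
    intro t
    induction t with
    | zero => exact ((hmemI _).1 hi0).2
    | succ t ih =>
      have := hE _ ih
      rw [hz.mem_edges] at this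
      obtain ⟨j, h | h⟩ := this
      · exact ⟨_, h.2.symm⟩
      · exact ⟨_, h.2.symm⟩
  have hallE : ∀ i, s(y i, y (i + 1)) ∈ cEdges z L := by
    intro i
    apply hE
    have := hallin (i + (M - 1) * i0)
    have e : y (i0 + (i + (M - 1) * i0)) = y i := by
      rw [hy.eq_iff]
      have : i0 + (i + (M - 1) * i0) = i + M * i0 := by
        obtain ⟨q, rfl⟩ : ∃ q, M = q + 1 := ⟨M - 1, by omega⟩
        simp; ring
      rw [this]
      exact Nat.add_modulus_mul_modEq_iff.2 rfl
    rwa [e] at this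
  -- the vertex set of `y` is closed under moving along `z`
  have hclosed : ∀ t, z t ∈ Set.range y → z (t + 1) ∈ Set.range y := by
    rintro t ⟨i, hi⟩
    have e1 := hallE i
    have e2 := hallE (i + (M - 1))
    have e3 : y (i + (M - 1) + 1) = y i := by
      have : i + (M - 1) + 1 = i + M := by omega
      rw [this, hy.per]
    rw [e3] at e2
    have hne : y (i + (M - 1)) ≠ y (i + 1) := by
      intro e
      rw [hy.eq_iff] at e
      have e1 := Nat.ModEq.add_left_cancel' i e
      unfold Nat.ModEq at e1
      rw [Nat.mod_eq_of_lt (by omega), Nat.mod_eq_of_lt (by omega)] at e1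
      omega
    rw [hi] at e1 e2
    rw [Sym2.eq_swap] at e2
    have e4 := hz.edge_mem t
    obtain ⟨w', k1, k2, k3⟩ := hz.two_reg _ _ e4
    rcases k3 _ e1 with h | h
    · exact ⟨_, h⟩
    · rcases k3 _ e2 with h' | h'
      · exact ⟨_, h'⟩
      · exact absurd (h'.trans h.symm) hne
  obtain ⟨t0, ht0⟩ := hallin 0
  have hall2 : ∀ s, z (t0 + s) ∈ Set.range y := by
    intro s
    induction s with
    | zero => exact ⟨_, ht0.symm⟩
    | succ s ih => exact hclosed _ ih
  have hcardle : L ≤ M := by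
    have h2 : ((Finset.range L).image (fun s => z (t0 + s))).card = L := by
      rw [Finset.card_image_of_injOn, Finset.card_range]
      intro i hi j hj h
      simp only [Finset.coe_range, Set.mem_Iio] at hi hj
      rw [hz.eq_iff] at h
      have := Nat.ModEq.add_left_cancel' t0 h
      unfold Nat.ModEq at this
      rwa [Nat.mod_eq_of_lt hi, Nat.mod_eq_of_lt hj] at this
    have h4 : ((Finset.range L).image (fun s => z (t0 + s))) ⊆ (Finset.range M).image y := by
      intro v hv
      simp only [Finset.mem_image, Finset.mem_range] at hv ⊢
      obtain ⟨s, _, rfl⟩ := hv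
      obtain ⟨i, hi⟩ := hall2 s
      exact ⟨i % M, Nat.mod_lt _ (by omega), by rw [hy.mod, hi]⟩
    have h5 := Finset.card_le_card h4
    have h6 := Finset.card_image_le (f := y) (s := Finset.range M)
    rw [Finset.card_range] at h6
    omega
  omega

end count


section bound
variable {V : Type} {G : SimpleGraph V} [Fintype V] [DecidableEq V]

/-- indicator of the "inner" part of a cycle -/
noncomputable def phi {V : Type} (z : ℕ → V) (k : ℕ) (v : V) : ZMod 2 :=
  open Classical in if ∃ t, 1 ≤ t ∧ t < k ∧ v = z t then 1 else 0

lemma phi_z {L k : ℕ} {z : ℕ → V} (hz : CycF G L z) (hk : k ≤ L) (t : ℕ) (ht : t ≤ L) :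
    phi z k (z t) = if 1 ≤ t ∧ t < k then 1 else 0 := by
  unfold phi
  congr 1
  rw [eq_iff_iff]
  constructor
  · rintro ⟨s, h1, h2, h3⟩
    rcases Nat.lt_or_ge t L with h | h
    · have := hz.inj t s h (by omega) h3
      omega
    · have e : t = L := by omega
      rw [e] at h3
      have e2 : z L = z 0 := by simpa using hz.per 0
      rw [e2] at h3
      have := hz.inj 0 s (by omega) (by omega) h3
      omega
  · rintro ⟨h1, h2⟩
    exact ⟨t, h1, h2, rfl⟩

lemma phi_edge {L k : ℕ} {z : ℕ → V} (hz : CycF G L z) (hk2 : 2 ≤ k) (hk : k ≤ L) (v w : V)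
    (h : s(v, w) ∈ cEdges z L) :
    phi z k w + phi z k v = (if s(v, w) = s(z 0, z 1) then 1 else 0) +
      (if s(v, w) = s(z (k-1), z k) then 1 else 0) := by
  have h3 := hz.three
  unfold cEdges at h
  simp only [Finset.mem_image, Finset.mem_range] at h
  obtain ⟨t, ht, e⟩ := h
  have key : phi z k (z (t+1)) + phi z k (z t) = (if s(z t, z (t+1)) = s(z 0, z 1) then 1 else 0) +
      (if s(z t, z (t+1)) = s(z (k-1), z k) then 1 else 0) := by
    rw [phi_z hz hk _ (by omega), phi_z hz hk _ (by omega)]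
    have i1 : s(z t, z (t+1)) = s(z 0, z 1) ↔ t = 0 :=
      ⟨fun h => hz.edge_inj t 0 ht (by omega) h, fun h => by rw [h]⟩
    have i2 : s(z t, z (t+1)) = s(z (k-1), z k) ↔ t = k - 1 := by
      have ek : k - 1 + 1 = k := by omega
      refine ⟨fun h => hz.edge_inj t (k-1) ht (by omega) (by rw [ek]; exact h), fun h => by rw [h, ek]⟩
    simp only [i1, i2]
    by_cases c1 : t = 0
    · rw [if_pos (by omega), if_neg (by omega), if_pos c1, if_neg (by omega)]
    · by_cases c2 : t = k - 1
      · rw [if_neg (by omega), if_pos (by omega), if_neg c1, if_pos c2]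
      · rw [if_neg c1, if_neg c2]
        by_cases c3 : t < k
        · rw [if_pos (by omega), if_pos (by omega)]; decide
        · rw [if_neg (by omega), if_neg (by omega)]
  rw [Sym2.eq_iff] at e
  rcases e with ⟨rfl, rfl⟩ | ⟨rfl, rfl⟩
  · exact key
  · rw [Sym2.eq_swap, add_comm]; exact key

set_option maxHeartbeats 1000000 in
lemma config_bound (hG : G.Connected) {L k c a : ℕ} {z y yg : ℕ → V} {x d : ℝ}
    (hcard : Fintype.card V + 1 = c + a) (ha : 1 ≤ a) (hag : 4 * a < G.girth) (hgc : G.girth < c)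
    (hmax : ∀ L z, CycF G L z → L ≤ c) (hy : CycF G c y) (hyg : CycF G G.girth yg)
    (hc : Config G L k z x d) : 4 * d ≤ (c : ℝ) - G.girth + 4 * a := by
  classical
  by_contra hcon
  push Not at hcon
  have hz := hc.cyc
  have z0 : z L = z 0 := by simpa using hz.per 0
  have hLc := hmax L z hz
  have hk2 := hc.k2
  have hkL := hc.kL
  have hL4 : 4 * d ≤ L := by
    have e1 := hc.d0k
    have e2 := hz.dist_le k L hc.kL
    rw [SimpleGraph.dist_comm, z0] at e2
    linarith
  obtain ⟨j, rfl⟩ : ∃ j, c = L + j := ⟨c - L, by omega⟩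
  set g := G.girth with hg
  have hj : j + 4 * a < g := by
    have : ((L + j : ℕ) : ℝ) - g + 4 * a < L := by linarith
    push_cast at this
    have : (j : ℝ) + 4 * a < g := by linarith
    exact_mod_cast this
  push_cast at hcon
  -- short ears are impossible
  have noear : ∀ i i' r, Ear G z L (z i) (z i') r → 1 ≤ i → i ≤ L → 1 ≤ i' → i' ≤ L →
      4 * r ≤ 4 * a + j → False := by
    intro i i' r h h1 h2 h3 h4 h5
    have h5' : 4 * (r : ℝ) ≤ 4 * a + j := by exact_mod_cast h5
    have hr0 : (0 : ℝ) ≤ r := by positivity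
    have hj0 : (0 : ℝ) ≤ j := by positivity
    have ha0 : (0 : ℝ) ≤ a := by positivity
    rcases hc.key hG h h1 h2 h3 h4 with ⟨_, _, e⟩ | ⟨_, _, e⟩ | ⟨_, e⟩
    · omega
    · linarith
    · linarith
  rcases Nat.eq_zero_or_pos j with rfl | hjpos
  · obtain ⟨i, i', r, h, h1, h2, h3, h4, h5, h6⟩ := exists_ear hz hyg (by omega) (by omega)
    exact noear i i' r h h1 h2 h3 h4 (by omega)
  have hy3 := hy.three
  have hin := in_count hz hy
  have hsum := sum_ret (S := Set.range z) hy
  set S := Set.range z with hS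
  set I := (Finset.range (L + j)).filter (fun i => y i ∈ S) with hI
  have hmemI : ∀ i, i ∈ I ↔ i < L + j ∧ y i ∈ S := by intro i; simp [hI]
  have hret1 : ∀ i ∈ I, 1 ≤ ret y S i := fun i hi => (ret_spec hy ((hmemI i).1 hi).2).1
  have hIc : I.card ≤ L + j := by
    have := Finset.card_filter_le (Finset.range (L + j)) (fun i => y i ∈ S)
    rwa [Finset.card_range] at this
  have hrle : ∀ i ∈ I, ret y S i ≤ j + a := by
    intro i hi
    have e2 : ∑ j ∈ I.erase i, 1 ≤ ∑ j ∈ I.erase i, ret y S j :=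
      Finset.sum_le_sum (fun j hj => hret1 j (Finset.mem_of_mem_erase hj))
    rw [← Finset.add_sum_erase I _ hi] at hsum
    have e3 := Finset.card_erase_of_mem hi
    have e4 : 0 < I.card := Finset.card_pos.2 ⟨i, hi⟩
    simp only [Finset.sum_const, smul_eq_mul, mul_one] at e2
    omega
  set J := I.filter (fun i => ¬ (ret y S i = 1 ∧ s(y i, y (i + 1)) ∈ cEdges z L)) with hJ
  set K := I.filter (fun i => (ret y S i = 1 ∧ s(y i, y (i + 1)) ∈ cEdges z L)) with hK
  have hKJ : K.card + J.card = I.card := Finset.card_filter_add_card_filter_not _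
  have hJI : ∀ i ∈ J, i ∈ I := fun i hi => (Finset.mem_filter.1 hi).1
  have hJear : ∀ i ∈ J, Ear G z L (y i) (y (i + ret y S i)) (ret y S i) := by
    intro i hi
    have hi' := hJI i hi
    have := hrle i hi'
    exact seg_ear hz hy ((hmemI i).1 hi').2
      (show ret y S i < L + j by omega) (Finset.mem_filter.1 hi).2
  have hJbig : ∀ i ∈ J, 4 * a + j < 4 * ret y S i := by
    intro i hi
    by_contra hle
    push Not at hle
    have his := ((hmemI i).1 (hJI i hi)).2
    have hear := hJear i hi
    obtain ⟨i1, a1, a2, a3⟩ := hz.index his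
    obtain ⟨j1, b1, b2, b3⟩ := hz.index (ret_spec hy his).2.1
    rw [a3, b3] at hear
    exact noear _ _ _ hear a1 a2 b1 b2 hle
  have hinter : K.card ≤ (cEdges z L ∩ cEdges y (L + j)).card := by
    apply Finset.card_le_card_of_injOn (fun i => s(y i, y (i + 1)))
    · intro i hi
      have hi := Finset.mem_filter.1 (Finset.mem_coe.1 hi)
      simp only [Finset.coe_inter, Set.mem_inter_iff, Finset.mem_coe]
      exact ⟨hi.2.2, hy.edge_mem i⟩
    · intro i hi i' hi' h
      have hi := Finset.mem_filter.1 (Finset.mem_coe.1 hi)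
      have hi' := Finset.mem_filter.1 (Finset.mem_coe.1 hi')
      exact hy.edge_inj i i' ((hmemI _).1 hi.1).1 ((hmemI _).1 hi'.1).1 h
  have hsd := girth_le_symmDiff hz hy (by omega)
  rw [← hg] at hsd
  have hm : a + 2 ≤ J.card := by omega
  have hsplit : ∑ i ∈ K, ret y S i + ∑ i ∈ J, ret y S i = ∑ i ∈ I, ret y S i :=
    Finset.sum_filter_add_sum_filter_not _ _ _
  have hKsum : K.card ≤ ∑ i ∈ K, ret y S i := by
    have : ∑ i ∈ K, 1 ≤ ∑ i ∈ K, ret y S i :=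
      Finset.sum_le_sum (fun i hi => hret1 i (Finset.mem_filter.1 hi).1)
    simpa using this
  have hJsum : J.card * (4 * a + j + 1) ≤ 4 * ∑ i ∈ J, ret y S i := by
    rw [Finset.mul_sum, ← smul_eq_mul, ← Finset.sum_const]
    exact Finset.sum_le_sum (fun i hi => hJbig i hi)
  have hm3 : J.card = 3 := by
    by_contra hne
    have h4 : 4 ≤ J.card := by omega
    obtain ⟨m, hm'⟩ : ∃ m, J.card = m + 4 := ⟨J.card - 4, by omega⟩
    rw [hm'] at hJsum hKJ
    have e1 : (m + 4) * (4 * a + j + 1) = 4 * (m * a) + m * j + m + 16 * a + 4 * j + 4 := by ring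
    have e2 : m ≤ m * a := Nat.le_mul_of_pos_right m (by omega)
    omega
  have ha1 : a = 1 := by omega
  subst ha1
  rw [hm3] at hJsum hKJ
  have hJ2 : ∀ i ∈ J, 2 * ret y S i ≤ j + 1 := by
    intro i hi
    have e1 := Finset.add_sum_erase J (ret y S) hi
    have e2 : (J.erase i).card * (4 * 1 + j + 1) ≤ 4 * ∑ i ∈ J.erase i, ret y S i := by
      rw [Finset.mul_sum, ← smul_eq_mul, ← Finset.sum_const]
      exact Finset.sum_le_sum (fun i hi => hJbig i (Finset.mem_of_mem_erase hi))
    rw [Finset.card_erase_of_mem hi, hm3] at e2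
    omega
  have hJphi : ∀ i ∈ J, phi z k (y (i + ret y S i)) + phi z k (y i) = 1 := by
    intro i hi
    have his := ((hmemI i).1 (hJI i hi)).2
    have hear := hJear i hi
    have h2 := hJ2 i hi
    obtain ⟨i1, a1, a2, a3⟩ := hz.index his
    obtain ⟨j1, b1, b2, b3⟩ := hz.index (ret_spec hy his).2.1
    rw [a3, b3] at hear ⊢
    rw [phi_z hz hkL _ a2, phi_z hz hkL _ b2]
    have h2' : 2 * (ret y S i : ℝ) ≤ j + 1 := by exact_mod_cast h2
    have hj0 : (0 : ℝ) ≤ j := by positivity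
    rcases hc.key hG hear a1 a2 b1 b2 with ⟨_, _, e⟩ | ⟨_, _, e⟩ | ⟨e1, e⟩
    · omega
    · push_cast at hcon
      linarith
    · by_cases h : i1 < k
      · rw [if_neg (by omega), if_pos (by omega)]; decide
      · rw [if_pos (by omega), if_neg (by omega)]; decide
  -- next-return permutation
  have nxtmem : ∀ i ∈ I, (i + ret y S i) % (L + j) ∈ I := by
    intro i hi
    rw [hmemI, hy.mod]
    exact ⟨Nat.mod_lt _ (by omega), (ret_spec hy ((hmemI i).1 hi).2).2.1⟩
  have nxtinj : Set.InjOn (fun i => (i + ret y S i) % (L + j)) (I : Set ℕ) := by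
    intro i hi i' hi' h
    have e1 := (hmemI i).1 hi
    have e2 := (hmemI i').1 hi'
    exact (ret_inj hy e1.1 e2.1 e1.2 e2.2 (hret1 i hi) le_rfl (hret1 i' hi') le_rfl h).1
  have nxtimg : I.image (fun i => (i + ret y S i) % (L + j)) = I := by
    apply Finset.eq_of_subset_of_card_le
    · intro t ht
      obtain ⟨i, hi, rfl⟩ := Finset.mem_image.1 ht
      exact nxtmem i hi
    · rw [Finset.card_image_of_injOn nxtinj]
  have hparity : ∑ i ∈ I, (phi z k (y (i + ret y S i)) + phi z k (y i)) = 0 := by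
    have e : ∑ i ∈ I, phi z k (y (i + ret y S i)) = ∑ i ∈ I, phi z k (y i) := by
      conv_rhs => rw [← nxtimg]
      rw [Finset.sum_image nxtinj]
      simp only [hy.mod]
    rw [Finset.sum_add_distrib, e]
    exact CharTwo.add_self_eq_zero _
  have hsur : ∀ v, ∃ i < L + j, y i = v := by
    intro v
    have h1 : ((Finset.range (L+j)).image y).card = L + j := by
      rw [Finset.card_image_of_injOn, Finset.card_range]
      intro i hi j hj h
      exact hy.inj i j (by simpa using hi) (by simpa using hj) h
    have h2 : (Finset.range (L+j)).image y = Finset.univ := by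
      rw [← Finset.card_eq_iff_eq_univ, h1]; omega
    have := Finset.mem_univ v
    rw [← h2] at this
    simpa using this
  have hsingle : ∀ t, s(z t, z (t+1)) ∈ cEdges y (L + j) →
      ∑ i ∈ K, (if s(y i, y (i+1)) = s(z t, z (t+1)) then (1 : ZMod 2) else 0) = 1 := by
    intro t ht
    have hte := hz.edge_mem t
    unfold cEdges at ht
    simp only [Finset.mem_image, Finset.mem_range] at ht
    obtain ⟨i0, h0, e0⟩ := ht
    have hin : y i0 ∈ S ∧ y (i0 + 1) ∈ S := by
      rw [Sym2.eq_iff] at e0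
      rcases e0 with ⟨e1, e2⟩ | ⟨e1, e2⟩
      · exact ⟨⟨_, e1.symm⟩, ⟨_, e2.symm⟩⟩
      · exact ⟨⟨_, e1.symm⟩, ⟨_, e2.symm⟩⟩
    have hK0 : i0 ∈ K := by
      rw [hK, Finset.mem_filter, hmemI]
      refine ⟨⟨h0, hin.1⟩, ?_, e0 ▸ hte⟩
      by_contra hne
      have := ret_spec hy hin.1
      exact this.2.2 1 le_rfl (by omega) hin.2
    rw [Finset.sum_eq_single_of_mem i0 hK0, if_pos e0]
    intro i hi hne
    rw [if_neg]
    intro h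
    exact hne (hy.edge_inj i i0 ((hmemI _).1 (Finset.mem_filter.1 hi).1).1 h0 (h.trans e0.symm))
  have notboth : ¬ (s(z 0, z 1) ∈ cEdges y (L + j) ∧ s(z (k-1), z k) ∈ cEdges y (L + j)) := by
    rintro ⟨b1, b2⟩
    have ek : k - 1 + 1 = k := by omega
    have s1 := hsingle 0 (by simpa using b1)
    have s2 := hsingle (k-1) (by rw [ek]; exact b2)
    rw [ek] at s2
    rw [← Finset.sum_filter_add_sum_filter_not I
      (fun i => (ret y S i = 1 ∧ s(y i, y (i + 1)) ∈ cEdges z L))] at hparity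
    rw [Finset.sum_congr rfl hJphi] at hparity
    have e3 : ∑ i ∈ K, (phi z k (y (i + ret y S i)) + phi z k (y i)) = 1 + 1 := by
      refine Eq.trans ?_ (congrArg₂ (· + ·) s1 s2)
      rw [← Finset.sum_add_distrib]
      apply Finset.sum_congr rfl
      intro i hi
      have hi := (Finset.mem_filter.1 hi).2
      rw [hi.1]
      exact phi_edge hz hk2 hkL _ _ hi.2
    rw [e3, Finset.sum_const, hm3] at hparity
    exact absurd hparity (by decide)
  have getear : ∀ v w, phi z k v = 0 → s(v, w) ∈ cEdges z L → s(v, w) ∉ cEdges y (L + j) →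
      ∃ t r, Ear G z L v (z t) r ∧ 1 ≤ t ∧ t < k ∧ 2 * r ≤ j + 1 := by
    intro v w hv hE0 hE
    have phi1 : ∀ u, phi z k u = 1 → ∃ t, 1 ≤ t ∧ t < k ∧ u = z t := by
      intro u hu
      unfold phi at hu
      by_contra hno
      rw [if_neg hno] at hu
      exact absurd hu (by decide)
    obtain ⟨i0, h0, rfl⟩ := hsur v
    have hvS : y i0 ∈ S := by
      rw [hz.mem_edges] at hE0
      obtain ⟨t, h | h⟩ := hE0
      · exact ⟨_, h.1.symm⟩
      · exact ⟨_, h.1.symm⟩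
    have hI0 : i0 ∈ I := (hmemI _).2 ⟨h0, hvS⟩
    by_cases hJ0 : i0 ∈ J
    · have e1 := hJphi i0 hJ0
      rw [hv, add_zero] at e1
      obtain ⟨t, t1, t2, t3⟩ := phi1 _ e1
      refine ⟨t, _, ?_, t1, t2, hJ2 i0 hJ0⟩
      rw [← t3]; exact hJear i0 hJ0
    obtain ⟨p, hp, hpe⟩ : ∃ p ∈ I, (p + ret y S p) % (L + j) = i0 := by
      have := hI0
      rw [← nxtimg] at this
      simpa using this
    have hpy : y (p + ret y S p) = y i0 := by rw [← hpe, hy.mod]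
    by_cases hJp : p ∈ J
    · have e1 := hJphi p hJp
      rw [hpy, hv, zero_add] at e1
      obtain ⟨t, t1, t2, t3⟩ := phi1 _ e1
      refine ⟨t, _, ?_, t1, t2, hJ2 p hJp⟩
      rw [← t3, ← hpy]; exact (hJear p hJp).symm
    exfalso
    have f1 : ret y S i0 = 1 ∧ s(y i0, y (i0 + 1)) ∈ cEdges z L := by
      by_contra hno; exact hJ0 (Finset.mem_filter.2 ⟨hI0, hno⟩)
    have f2 : ret y S p = 1 ∧ s(y p, y (p + 1)) ∈ cEdges z L := by
      by_contra hno; exact hJp (Finset.mem_filter.2 ⟨hp, hno⟩)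
    rw [f2.1] at hpy hpe
    have f3 := f2.2
    have f4 := hy.edge_mem p
    have f5 := hy.edge_mem i0
    rw [hpy, Sym2.eq_swap] at f3 f4
    have hne : y p ≠ y (i0 + 1) := by
      intro h
      have h2 : y (i0 + 1) = y (p + 2) := by
        rw [hy.eq_iff, ← hpe]
        exact Nat.ModEq.add_right 1 (Nat.mod_modEq _ _)
      rw [h2, hy.eq_iff] at h
      have e1 : p + 0 ≡ p + 2 [MOD L + j] := h
      have e2 := Nat.ModEq.add_left_cancel' p e1
      unfold Nat.ModEq at e2
      rw [Nat.mod_eq_of_lt (by omega), Nat.mod_eq_of_lt (by omega)] at e2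
      omega
    obtain ⟨w', k1, k2, k3⟩ := hz.two_reg _ _ hE0
    rcases k3 _ f3 with h | h
    · rw [h] at f4; exact hE f4
    · rcases k3 _ f1.2 with h' | h'
      · rw [h'] at f5; exact hE f5
      · exact hne (h.trans h'.symm)
  by_cases b1 : s(z 0, z 1) ∈ cEdges y (L + j)
  · have b2 : s(z (k-1), z k) ∉ cEdges y (L + j) := fun b2 => notboth ⟨b1, b2⟩
    have ek : k - 1 + 1 = k := by omega
    obtain ⟨t, r, hear, t1, t2, hr⟩ := getear (z k) (z (k-1))
      (by rw [phi_z hz hkL _ hkL, if_neg (by omega)])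
      (by have := hz.edge_mem (k-1); rw [ek, Sym2.eq_swap] at this; exact this)
      (by rw [Sym2.eq_swap]; exact b2)
    have e1 := ear_arc hz hear.symm (by omega) (by omega)
    have e2 := hc.dk t t1 t2
    have e3 := hear.dist_le
    have e4 := hc.hi0
    have e5 : (k : ℝ) - t < r + 2 := by linarith
    have e6 : k < r + 2 + t := by
      have : (k : ℝ) < r + 2 + t := by linarith
      exact_mod_cast this
    have e7 : g + t ≤ k + r := by
      have : (g : ℝ) + t ≤ k + r := by linarith
      exact_mod_cast this
    omega
  · obtain ⟨t, r, hear, t1, t2, hr⟩ := getear (z 0) (z 1)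
      (by rw [phi_z hz hkL _ (by omega), if_neg (by omega)])
      (hz.edge_mem 0) b1
    have e1 := ear_arc hz hear (by omega) (by omega)
    have e2 := hc.d0 t t1 t2
    have e3 := hear.dist_le
    have e4 := hc.lo1
    have e6 : t < r + 2 := by
      have : (t : ℝ) < r + 2 := by linarith
      exact_mod_cast this
    have e7 : g ≤ t + r := by
      have : (g : ℝ) ≤ t + r := by push_cast at e1; linarith
      exact_mod_cast this
    omega

end bound


section mg
variable {V : Type} [Fintype V] [DecidableEq V] {G : SimpleGraph V}

lemma conn_dist_lt (hG : G.Connected) (u v : V) : G.dist u v + 1 ≤ Fintype.card V := by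
  obtain ⟨p, hp⟩ := hG.exists_walk_length_eq_dist u v
  have h1 := p.isPath_of_length_eq_dist hp
  have := h1.length_lt
  omega

lemma mgDist_eq (P Q : MGPoint G) : mgDist G P Q =
    min (min (if P.1.1 = Q.1.1 ∧ P.1.2.1 = Q.1.2.1 then |P.1.2.2 - Q.1.2.2| else (Fintype.card V : ℝ) + 1)
         (if P.1.1 = Q.1.2.1 ∧ P.1.2.1 = Q.1.1 then |P.1.2.2 - (1 - Q.1.2.2)| else (Fintype.card V : ℝ) + 1))
      (min (P.1.2.2 + mgVDist G P.1.1 Q) (1 - P.1.2.2 + mgVDist G P.1.2.1 Q)) := by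
  unfold mgDist mgDistAux mgVDist
  rw [← min_add_add_left, ← min_add_add_left]
  simp only [add_assoc]

lemma mgDist_le_fst (P Q : MGPoint G) : mgDist G P Q ≤ P.1.2.2 + mgVDist G P.1.1 Q := by
  rw [mgDist_eq]; exact (min_le_right _ _).trans (min_le_left _ _)

lemma mgDist_le_snd (P Q : MGPoint G) : mgDist G P Q ≤ 1 - P.1.2.2 + mgVDist G P.1.2.1 Q := by
  rw [mgDist_eq]; exact (min_le_right _ _).trans (min_le_right _ _)

lemma mgDist_le_same (P Q : MGPoint G) (h1 : P.1.1 = Q.1.1) (h2 : P.1.2.1 = Q.1.2.1) :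
    mgDist G P Q ≤ |P.1.2.2 - Q.1.2.2| := by
  rw [mgDist_eq, if_pos ⟨h1, h2⟩]; exact (min_le_left _ _).trans (min_le_left _ _)

lemma mgDist_le_opp (P Q : MGPoint G) (h1 : P.1.1 = Q.1.2.1) (h2 : P.1.2.1 = Q.1.1) :
    mgDist G P Q ≤ |P.1.2.2 - (1 - Q.1.2.2)| := by
  rw [mgDist_eq, if_pos (⟨h1, h2⟩ : P.1.1 = Q.1.2.1 ∧ P.1.2.1 = Q.1.1)]
  exact (min_le_left _ _).trans (min_le_right _ _)

lemma mgVDist_le_fst (v : V) (Q : MGPoint G) : mgVDist G v Q ≤ G.dist v Q.1.1 + Q.1.2.2 :=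
  min_le_left _ _

lemma mgVDist_le_snd (v : V) (Q : MGPoint G) : mgVDist G v Q ≤ G.dist v Q.1.2.1 + (1 - Q.1.2.2) :=
  min_le_right _ _

lemma mgVDist_cases (v : V) (Q : MGPoint G) : mgVDist G v Q = G.dist v Q.1.1 + Q.1.2.2 ∨
    mgVDist G v Q = G.dist v Q.1.2.1 + (1 - Q.1.2.2) := min_choice _ _

lemma mgVDist_le_card (hG : G.Connected) (v : V) (Q : MGPoint G) :
    mgVDist G v Q ≤ Fintype.card V - 1 / 2 := by
  have h1 := mgVDist_le_fst v Q
  have h2 := mgVDist_le_snd v Q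
  have h3 : (G.dist v Q.1.1 : ℝ) + 1 ≤ Fintype.card V := by exact_mod_cast conn_dist_lt hG _ _
  have h4 : (G.dist v Q.1.2.1 : ℝ) + 1 ≤ Fintype.card V := by exact_mod_cast conn_dist_lt hG _ _
  rcases le_total Q.1.2.2 (1/2) with h | h <;> linarith

lemma mgDist_le_card (hG : G.Connected) (P Q : MGPoint G) :
    mgDist G P Q ≤ Fintype.card V := by
  have h1 := mgDist_le_fst P Q
  have h2 := mgDist_le_snd P Q
  have h3 := mgVDist_le_card hG P.1.1 Q
  have h4 := mgVDist_le_card hG P.1.2.1 Q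
  rcases le_total P.1.2.2 (1/2) with h | h <;> linarith

lemma mgDist_cases (hG : G.Connected) (P Q : MGPoint G) :
    (P.1.1 = Q.1.1 ∧ P.1.2.1 = Q.1.2.1 ∧ mgDist G P Q = |P.1.2.2 - Q.1.2.2|) ∨
    (P.1.1 = Q.1.2.1 ∧ P.1.2.1 = Q.1.1 ∧ mgDist G P Q = |P.1.2.2 - (1 - Q.1.2.2)|) ∨
    mgDist G P Q = P.1.2.2 + mgVDist G P.1.1 Q ∨
    mgDist G P Q = 1 - P.1.2.2 + mgVDist G P.1.2.1 Q := by
  have hle := mgDist_le_card hG P Q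
  have h := mgDist_eq P Q
  rcases min_choice (min (if P.1.1 = Q.1.1 ∧ P.1.2.1 = Q.1.2.1 then |P.1.2.2 - Q.1.2.2| else (Fintype.card V : ℝ) + 1)
         (if P.1.1 = Q.1.2.1 ∧ P.1.2.1 = Q.1.1 then |P.1.2.2 - (1 - Q.1.2.2)| else (Fintype.card V : ℝ) + 1))
      (min (P.1.2.2 + mgVDist G P.1.1 Q) (1 - P.1.2.2 + mgVDist G P.1.2.1 Q)) with e | e
  · rw [e] at h
    rcases min_choice (if P.1.1 = Q.1.1 ∧ P.1.2.1 = Q.1.2.1 then |P.1.2.2 - Q.1.2.2| else (Fintype.card V : ℝ) + 1)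
         (if P.1.1 = Q.1.2.1 ∧ P.1.2.1 = Q.1.1 then |P.1.2.2 - (1 - Q.1.2.2)| else (Fintype.card V : ℝ) + 1) with e | e
    · rw [e] at h
      split_ifs at h with h1
      · exact Or.inl ⟨h1.1, h1.2, h⟩
      · linarith
    · rw [e] at h
      split_ifs at h with h1
      · exact Or.inr (Or.inl ⟨h1.1, h1.2, h⟩)
      · linarith
  · rw [e] at h
    rcases min_choice (P.1.2.2 + mgVDist G P.1.1 Q) (1 - P.1.2.2 + mgVDist G P.1.2.1 Q) with e | e
    · rw [e] at h; exact Or.inr (Or.inr (Or.inl h))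
    · rw [e] at h; exact Or.inr (Or.inr (Or.inr h))

lemma mgVDist_lip (hG : G.Connected) (v w : V) (Q : MGPoint G) :
    mgVDist G v Q ≤ G.dist v w + mgVDist G w Q := by
  have t1 : (G.dist v Q.1.1 : ℝ) ≤ G.dist v w + G.dist w Q.1.1 := by
    exact_mod_cast hG.dist_triangle
  have t2 : (G.dist v Q.1.2.1 : ℝ) ≤ G.dist v w + G.dist w Q.1.2.1 := by
    exact_mod_cast hG.dist_triangle
  have := mgVDist_le_fst v Q
  have := mgVDist_le_snd v Q
  rcases mgVDist_cases w Q with h | h <;> linarith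

lemma mgVDist_nonneg (v : V) (Q : MGPoint G) : 0 ≤ mgVDist G v Q := by
  have h1 := Q.2.2.1
  have h2 := Q.2.2.2
  have h3 : (0:ℝ) ≤ G.dist v Q.1.1 := by positivity
  have h4 : (0:ℝ) ≤ G.dist v Q.1.2.1 := by positivity
  rcases mgVDist_cases v Q with h | h <;> linarith

/-- reverse the orientation of the edge carrying a point -/
def mgFlip (P : MGPoint G) : MGPoint G :=
  ⟨(P.1.2.1, P.1.1, 1 - P.1.2.2), P.2.1.symm, by
    have h1 := P.2.2.1
    have h2 := P.2.2.2
    exact ⟨by linarith, by linarith⟩⟩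

lemma mgVDist_flip (v : V) (Q : MGPoint G) : mgVDist G v (mgFlip Q) = mgVDist G v Q := by
  unfold mgVDist mgFlip
  simp only [sub_sub_cancel]
  rw [min_comm]

lemma mgDist_flip_left (P Q : MGPoint G) : mgDist G (mgFlip P) Q = mgDist G P Q := by
  rw [mgDist_eq, mgDist_eq]
  simp only [mgFlip, sub_sub_cancel]
  rw [min_comm (1 - P.1.2.2 + _)]
  rw [min_comm (ite _ _ _)]
  refine congrArg₂ min (congrArg₂ min (if_congr and_comm ?_ rfl) (if_congr and_comm ?_ rfl)) rfl
  · rw [abs_sub_comm]; congr 1; ring_nf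
  · rw [abs_sub_comm]; congr 1; ring_nf

lemma mgDist_comm (P Q : MGPoint G) : mgDist G P Q = mgDist G Q P := by
  unfold mgDist mgDistAux
  simp only [SimpleGraph.dist_comm (u := Q.1.1), SimpleGraph.dist_comm (u := Q.1.2.1)]
  congr 1
  · congr 1
    · simp only [eq_comm (a := Q.1.1), eq_comm (a := Q.1.2.1), abs_sub_comm]
    · simp only [eq_comm (a := Q.1.1), eq_comm (a := Q.1.2.1)]
      refine if_congr and_comm ?_ rfl
      congr 1; ring
  · rw [min_min_min_comm]
    congr 2
    all_goals first | ring | (congr 1 <;> ring)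

lemma mgDist_flip_right (P Q : MGPoint G) : mgDist G P (mgFlip Q) = mgDist G P Q := by
  rw [mgDist_comm, mgDist_flip_left, mgDist_comm]

/-- vertex triangle inequality -/
lemma mgVDist_tri (hG : G.Connected) (v : V) (P Q : MGPoint G) :
    mgVDist G v Q ≤ mgVDist G v P + mgDist G P Q := by
  have p1 := P.2.2.1
  have p2 := P.2.2.2
  have a1 := mgVDist_le_fst v Q
  have a2 := mgVDist_le_snd v Q
  have a3 := mgVDist_lip hG v P.1.1 Q
  have a4 := mgVDist_lip hG v P.1.2.1 Q
  have adj1 : G.dist P.1.1 P.1.2.1 = 1 := dist_eq_one_iff_adj.2 P.2.1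
  have b1 := mgVDist_lip hG P.1.1 P.1.2.1 Q
  have b2 := mgVDist_lip hG P.1.2.1 P.1.1 Q
  rw [dist_comm] at b2
  rw [adj1] at b1 b2
  push_cast at b1 b2
  rcases mgDist_cases hG P Q with ⟨h1, h2, h⟩ | ⟨h1, h2, h⟩ | h | h
  · rcases mgVDist_cases v P with e | e
    · rw [h1] at e; rw [h, e]; have := neg_abs_le (P.1.2.2 - Q.1.2.2); linarith
    · rw [h2] at e; rw [h, e]; have := le_abs_self (P.1.2.2 - Q.1.2.2); linarith
  · rcases mgVDist_cases v P with e | e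
    · rw [h1] at e; rw [h, e]; have := neg_abs_le (P.1.2.2 - (1 - Q.1.2.2)); linarith
    · rw [h2] at e; rw [h, e]; have := le_abs_self (P.1.2.2 - (1 - Q.1.2.2)); linarith
  · rcases mgVDist_cases v P with e | e <;> rw [h, e] <;> linarith
  · rcases mgVDist_cases v P with e | e <;> rw [h, e] <;> linarith

lemma mgVDist_fst (hG : G.Connected) (P Q : MGPoint G) :
    mgVDist G P.1.1 Q ≤ P.1.2.2 + mgDist G P Q := by
  have h1 := mgVDist_tri hG P.1.1 P Q
  have h2 := mgVDist_le_fst P.1.1 P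
  simp only [SimpleGraph.dist_self, Nat.cast_zero, zero_add] at h2
  linarith

lemma mgVDist_snd (hG : G.Connected) (P Q : MGPoint G) :
    mgVDist G P.1.2.1 Q ≤ 1 - P.1.2.2 + mgDist G P Q := by
  have h1 := mgVDist_tri hG P.1.2.1 P Q
  have h2 := mgVDist_le_snd P.1.2.1 P
  simp only [SimpleGraph.dist_self, Nat.cast_zero, zero_add] at h2
  linarith

lemma mgDist_tri (hG : G.Connected) (P Q R : MGPoint G) :
    mgDist G P R ≤ mgDist G P Q + mgDist G Q R := by
  have a1 := mgDist_le_fst P R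
  have a2 := mgDist_le_snd P R
  have main : ∀ P' : MGPoint G, P'.1.1 = Q.1.1 → P'.1.2.1 = Q.1.2.1 →
      mgDist G P' R ≤ |P'.1.2.2 - Q.1.2.2| + mgDist G Q R := by
    intro P' h1 h2
    have a1 := mgDist_le_fst P' R
    have a2 := mgDist_le_snd P' R
    rw [h1] at a1
    rw [h2] at a2
    have l1 := neg_abs_le (P'.1.2.2 - Q.1.2.2)
    have l2 := le_abs_self (P'.1.2.2 - Q.1.2.2)
    rcases mgDist_cases hG Q R with ⟨h3, h4, h⟩ | ⟨h3, h4, h⟩ | h | h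
    · have := mgDist_le_same P' R (h1.trans h3) (h2.trans h4)
      have := abs_sub_le P'.1.2.2 Q.1.2.2 R.1.2.2
      linarith
    · have := mgDist_le_opp P' R (h1.trans h3) (h2.trans h4)
      have := abs_sub_le P'.1.2.2 Q.1.2.2 (1 - R.1.2.2)
      linarith
    · linarith
    · linarith
  rcases mgDist_cases hG P Q with ⟨h1, h2, h⟩ | ⟨h1, h2, h⟩ | h | h
  · rw [h]; exact main P h1 h2
  · have := main (mgFlip P) h2 h1
    rw [mgDist_flip_left] at this
    rw [h]
    convert this using 2
    simp only [mgFlip]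
    rw [abs_sub_comm]; congr 1; ring
  · have := mgVDist_tri hG P.1.1 Q R
    linarith
  · have := mgVDist_tri hG P.1.2.1 Q R
    linarith

lemma mgDist_via (P Q : MGPoint G) (hG : G.Connected) (u v : V) (a b : ℝ)
    (hu : mgVDist G u P ≤ a) (hv : mgVDist G v Q ≤ b) : mgDist G P Q ≤ a + G.dist u v + b := by
  have h1 := mgDist_le_fst P Q
  have h2 := mgDist_le_snd P Q
  have h3 := mgVDist_lip hG P.1.1 u Q
  have h4 := mgVDist_lip hG P.1.2.1 u Q
  have h5 := mgVDist_lip hG u v Q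
  rcases mgVDist_cases u P with h | h
  · rw [dist_comm] at h; linarith
  · rw [dist_comm] at h; linarith

end mg


section extract
variable {V : Type} [Fintype V] [DecidableEq V] {G : SimpleGraph V}

lemma walk_geo (hG : G.Connected) {u v : V} (W : G.Walk u v) (hW : W.length = G.dist u v)
    (i j : ℕ) (hij : i ≤ j) (hj : j ≤ W.length) :
    (G.dist (W.getVert i) (W.getVert j) : ℝ) = j - i := by
  have up : ∀ i j, i ≤ j → j ≤ W.length → G.dist (W.getVert i) (W.getVert j) ≤ j - i := by
    intro i j hij hj
    obtain ⟨w, h1, _⟩ := walk_of_fun (G := G) (fun t => W.getVert (i + t)) (j - i)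
      (fun t ht => W.adj_getVert_succ (by omega))
    have h2 := SimpleGraph.dist_le w
    rw [h1] at h2
    simpa [Nat.add_sub_cancel' hij] using h2
  have u1 := up 0 i (by omega) (by omega)
  have u2 := up i j hij hj
  have u3 := up j W.length hj le_rfl
  rw [Walk.getVert_zero] at u1
  rw [Walk.getVert_length] at u3
  have t1 : G.dist u v ≤ G.dist u (W.getVert i) + G.dist (W.getVert i) v := hG.dist_triangle
  have t2 : G.dist (W.getVert i) v ≤ G.dist (W.getVert i) (W.getVert j) + G.dist (W.getVert j) v :=
    hG.dist_triangle
  have : G.dist (W.getVert i) (W.getVert j) = j - i := by omega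
  rw [this, Nat.cast_sub hij]

lemma geo_path (hG : G.Connected) (p : MGPoint G) (u v : V)
    (h : mgVDist G u p + mgVDist G v p ≤ G.dist u v) :
    ∃ W : G.Walk u v, W.length = G.dist u v ∧ (W.length : ℝ) = mgVDist G u p + mgVDist G v p ∧
      ∀ i ≤ W.length, mgVDist G (W.getVert i) p ≤ |(i : ℝ) - mgVDist G u p| := by
  have main : ∀ p : MGPoint G, mgVDist G u p + mgVDist G v p ≤ G.dist u v →
      mgVDist G u p = G.dist u p.1.1 + p.1.2.2 →
      ∃ W : G.Walk u v, W.length = G.dist u v ∧ (W.length : ℝ) = mgVDist G u p + mgVDist G v p ∧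
      ∀ i ≤ W.length, mgVDist G (W.getVert i) p ≤ |(i : ℝ) - mgVDist G u p| := by
    intro p h hu
    obtain ⟨W1, hW1⟩ := hG.exists_walk_length_eq_dist u p.1.1
    have s0 := p.2.2.1
    have s1 := p.2.2.2
    rcases mgVDist_cases v p with hv | hv
    · obtain ⟨W2, hW2⟩ := hG.exists_walk_length_eq_dist p.1.1 v
      have hl : (W1.append W2).length = W1.length + W2.length := Walk.length_append _ _
      have hd := SimpleGraph.dist_le (W1.append W2)
      rw [hl] at hd
      have hd' : (G.dist u v : ℝ) ≤ W1.length + W2.length := by exact_mod_cast hd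
      rw [SimpleGraph.dist_comm, ← hW2] at hv
      rw [← hW1] at hu
      have hs : p.1.2.2 = 0 := by linarith
      rw [hs] at hu hv
      have hlen : (W1.append W2).length = G.dist u v := by
        rw [hl]
        have : ((W1.length + W2.length : ℕ) : ℝ) ≤ G.dist u v := by push_cast; linarith
        have : W1.length + W2.length ≤ G.dist u v := by exact_mod_cast this
        omega
      have hm : (W1.append W2).getVert W1.length = p.1.1 := by
        rw [Walk.getVert_append]; simp
      refine ⟨W1.append W2, hlen, by rw [hl]; push_cast; linarith, ?_⟩
      intro i hi
      have e1 := mgVDist_le_fst ((W1.append W2).getVert i) p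
      rcases le_total i W1.length with hc | hc
      · have := walk_geo hG _ hlen i W1.length hc (by omega)
        rw [hm] at this
        have := neg_le_abs ((i:ℝ) - mgVDist G u p)
        linarith
      · have := walk_geo hG _ hlen W1.length i hc hi
        rw [hm, SimpleGraph.dist_comm] at this
        have := le_abs_self ((i:ℝ) - mgVDist G u p)
        linarith
    · obtain ⟨W2, hW2⟩ := hG.exists_walk_length_eq_dist p.1.2.1 v
      have hl : (W1.append (Walk.cons p.2.1 W2)).length = W1.length + (W2.length + 1) := by
        rw [Walk.length_append, Walk.length_cons]
      have hd := SimpleGraph.dist_le (W1.append (Walk.cons p.2.1 W2))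
      rw [hl] at hd
      have hd' : (G.dist u v : ℝ) ≤ W1.length + (W2.length + 1) := by exact_mod_cast hd
      rw [SimpleGraph.dist_comm, ← hW2] at hv
      rw [← hW1] at hu
      have hlen : (W1.append (Walk.cons p.2.1 W2)).length = G.dist u v := by
        rw [hl]
        have : ((W1.length + (W2.length + 1) : ℕ) : ℝ) ≤ G.dist u v := by push_cast; linarith
        have : W1.length + (W2.length + 1) ≤ G.dist u v := by exact_mod_cast this
        omega
      have hm : (W1.append (Walk.cons p.2.1 W2)).getVert W1.length = p.1.1 := by
        rw [Walk.getVert_append]; simp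
      have hm1 : (W1.append (Walk.cons p.2.1 W2)).getVert (W1.length + 1) = p.1.2.1 := by
        rw [Walk.getVert_append]; simp
      refine ⟨W1.append (Walk.cons p.2.1 W2), hlen, by rw [hl]; push_cast; linarith, ?_⟩
      intro i hi
      rcases Nat.lt_or_ge W1.length i with hc | hc
      · have e1 := mgVDist_le_snd ((W1.append (Walk.cons p.2.1 W2)).getVert i) p
        have := walk_geo hG _ hlen (W1.length + 1) i hc hi
        rw [hm1, SimpleGraph.dist_comm] at this
        have := le_abs_self ((i:ℝ) - mgVDist G u p)
        push_cast at *
        linarith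
      · have e1 := mgVDist_le_fst ((W1.append (Walk.cons p.2.1 W2)).getVert i) p
        have := walk_geo hG _ hlen i W1.length hc (by omega)
        rw [hm] at this
        have := neg_le_abs ((i:ℝ) - mgVDist G u p)
        linarith
  rcases mgVDist_cases u p with hu | hu
  · exact main p h hu
  · have := main (mgFlip p) (by simpa only [mgVDist_flip] using h)
      (by rw [mgVDist_flip]; exact hu)
    simpa only [mgVDist_flip] using this

lemma CycF_of {L : ℕ} (h3 : 3 ≤ L) (f : ℕ → V) (hadj : ∀ i < L, G.Adj (f i) (f (i + 1)))
    (h0 : f L = f 0) (hinj : ∀ i j, i < L → j < L → f i = f j → i = j) :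
    CycF G L (fun t => f (t % L)) ∧ ∀ t ≤ L, f (t % L) = f t := by
  have hle : ∀ t ≤ L, f (t % L) = f t := by
    intro t ht
    rcases Nat.lt_or_ge t L with h | h
    · rw [Nat.mod_eq_of_lt h]
    · have : t = L := by omega
      rw [this, Nat.mod_self, h0]
  refine ⟨⟨h3, ?_, ?_, ?_⟩, hle⟩
  · intro i
    have hlt := Nat.mod_lt i (show 0 < L by omega)
    have e : f ((i + 1) % L) = f (i % L + 1) := by
      rw [← hle _ (by omega : i % L + 1 ≤ L)]
      congr 1
      simp [Nat.add_mod]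
    rw [e]
    exact hadj _ hlt
  · intro i; simp
  · intro i j hi hj h
    simp only [Nat.mod_eq_of_lt hi, Nat.mod_eq_of_lt hj] at h
    exact hinj i j hi hj h

set_option maxHeartbeats 1000000 in
lemma config_of (hG : G.Connected) (p X Y : MGPoint G) (δ D : ℝ) (hD : 1 ≤ D) (hδ : D < δ)
    (hdich : ∀ v, mgVDist G v p ≤ D ∨ δ < mgVDist G v p)
    (hX : δ = 1 - X.1.2.2 + mgVDist G X.1.2.1 p) (hY : δ = 1 - Y.1.2.2 + mgVDist G Y.1.2.1 p)
    (hXp : mgDist G X p = δ) (hYp : mgDist G Y p = δ)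
    (hXY : mgDist G X Y = 2 * δ)
    (hB : ∃ w : G.Walk Y.1.1 X.1.1, ∀ u ∈ w.support, δ < mgVDist G u p) :
    ∃ L k z x, Config G L k z x δ := by
  obtain ⟨X, ⟨hXadj, hX0, hX1⟩⟩ := X
  obtain ⟨Y, ⟨hYadj, hY0, hY1⟩⟩ := Y
  obtain ⟨α0, α1, η⟩ := X
  obtain ⟨β0, β1, θ⟩ := Y
  simp only at hX hY hB hXadj hYadj hX0 hX1 hY0 hY1
  obtain ⟨B', hB'⟩ := hB
  obtain ⟨B, hBp, hBo⟩ : ∃ B : G.Walk β0 α0, B.IsPath ∧ ∀ u ∈ B.support, δ < mgVDist G u p :=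
    ⟨B'.bypass, B'.bypass_isPath, fun u hu => hB' u (B'.support_bypass_subset hu)⟩
  have hα0 : δ < mgVDist G α0 p := hBo _ B.end_mem_support
  have hβ0 : δ < mgVDist G β0 p := hBo _ B.start_mem_support
  have hα1 : mgVDist G α1 p ≤ D := by
    rcases hdich α1 with h | h
    · exact h
    · linarith
  have hβ1 : mgVDist G β1 p ≤ D := by
    rcases hdich β1 with h | h
    · exact h
    · linarith
  have hη1 : η < 1 := by linarith
  have hθ1 : θ < 1 := by linarith
  have hη0 : 0 < η := by
    have := mgVDist_fst hG ⟨(α0, α1, η), hXadj, hX0, hX1⟩ p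
    rw [hXp] at this
    simp only at this
    linarith
  have hθ0 : 0 < θ := by
    have := mgVDist_fst hG ⟨(β0, β1, θ), hYadj, hY0, hY1⟩ p
    rw [hYp] at this
    simp only at this
    linarith
  have via : ∀ u v : V, ∀ a b : ℝ,
      mgVDist G u ⟨(α0, α1, η), hXadj, hX0, hX1⟩ ≤ a →
      mgVDist G v ⟨(β0, β1, θ), hYadj, hY0, hY1⟩ ≤ b → 2 * δ ≤ a + G.dist u v + b := by
    intro u v a b h1 h2
    rw [← hXY]
    exact mgDist_via _ _ hG u v a b h1 h2
  have x0 : mgVDist G α0 ⟨(α0, α1, η), hXadj, hX0, hX1⟩ ≤ η := by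
    have := mgVDist_le_fst α0 ⟨(α0, α1, η), hXadj, hX0, hX1⟩
    simpa using this
  have x1 : mgVDist G α1 ⟨(α0, α1, η), hXadj, hX0, hX1⟩ ≤ 1 - η := by
    have := mgVDist_le_snd α1 ⟨(α0, α1, η), hXadj, hX0, hX1⟩
    simpa using this
  have y0 : mgVDist G β0 ⟨(β0, β1, θ), hYadj, hY0, hY1⟩ ≤ θ := by
    have := mgVDist_le_fst β0 ⟨(β0, β1, θ), hYadj, hY0, hY1⟩
    simpa using this
  have y1 : mgVDist G β1 ⟨(β0, β1, θ), hYadj, hY0, hY1⟩ ≤ 1 - θ := by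
    have := mgVDist_le_snd β1 ⟨(β0, β1, θ), hYadj, hY0, hY1⟩
    simpa using this
  obtain ⟨W, hWd, hWl, hWf⟩ := geo_path hG p α1 β1 (by
    have := via _ _ _ _ x1 y1
    linarith)
  have hgeo := walk_geo hG W hWd
  set K := W.length with hK
  have hKδ : (K : ℝ) + 2 = 2 * δ + η + θ := by linarith
  have hBpos : 0 < B.length := by
    by_contra h
    have hlen : B.length = 0 := by omega
    have : β0 = α0 := Walk.eq_of_length_eq_zero hlen
    have h2 := via _ _ _ _ x0 y0
    rw [this, SimpleGraph.dist_self] at h2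
    push_cast at h2
    linarith
  have hKpos : 0 < K := by
    by_contra h
    have : K = 0 := by omega
    rw [this] at hKδ
    push_cast at hKδ
    linarith
  have hWin : ∀ i ≤ K, mgVDist G (W.getVert i) p < δ := by
    intro i hi
    have h1 := hWf i hi
    have hi' : (i : ℝ) ≤ K := by exact_mod_cast hi
    have : |(i : ℝ) - mgVDist G α1 p| < δ := by
      rw [abs_lt]
      have : (0 : ℝ) ≤ i := by positivity
      constructor <;> linarith
    linarith
  have hBout : ∀ i, δ < mgVDist G (B.getVert i) p := fun i => hBo _ (B.getVert_mem_support i)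
  set f : ℕ → V := fun t => if t = 0 then α0 else if t < K + 2 then W.getVert (t - 1)
    else B.getVert (t - (K + 2)) with hf
  have f0 : f 0 = α0 := by simp [hf]
  have fW : ∀ i, i ≤ K → f (i + 1) = W.getVert i := by
    intro i hi
    simp only [hf]
    rw [if_neg (by omega), if_pos (by omega)]; simp
  have fB : ∀ i, f (K + 2 + i) = B.getVert i := by
    intro i
    simp only [hf]
    rw [if_neg (by omega), if_neg (by omega)]; simp
  have fcase : ∀ t, t = 0 ∨ (∃ i, i ≤ K ∧ t = i + 1) ∨ (∃ i, t = K + 2 + i) := by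
    intro t
    rcases Nat.eq_zero_or_pos t with h | h
    · exact Or.inl h
    · rcases Nat.lt_or_ge t (K + 2) with h2 | h2
      · exact Or.inr (Or.inl ⟨t - 1, by omega, by omega⟩)
      · exact Or.inr (Or.inr ⟨t - (K + 2), by omega⟩)
  obtain ⟨hcyc, hle⟩ := CycF_of (G := G) (L := K + 2 + B.length) (by omega) f (by
    intro i hi
    rcases fcase i with rfl | ⟨s, hs, rfl⟩ | ⟨s, rfl⟩
    · rw [f0, fW 0 (by omega), Walk.getVert_zero]; exact hXadj
    · rw [fW s hs]
      rcases Nat.lt_or_ge s K with h | h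
      · rw [fW (s + 1) (by omega)]
        exact W.adj_getVert_succ h
      · have : s = K := by omega
        subst this
        have := fB 0
        rw [add_zero] at this
        rw [show K + 1 + 1 = K + 2 by ring, this, Walk.getVert_zero, hK, Walk.getVert_length]
        exact hYadj.symm
    · rw [add_assoc (K + 2), fB, fB]
      exact B.adj_getVert_succ (by omega)) (by
    rw [fB, Walk.getVert_length, f0]) (by
    have winj : ∀ i j, i ≤ j → j ≤ K → W.getVert i = W.getVert j → i = j := by
      intro i j hij hj h
      have := hgeo i j hij hj
      rw [h, SimpleGraph.dist_self] at this
      push_cast at this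
      have : (i : ℝ) = j := by linarith
      exact_mod_cast this
    have binj : ∀ i j, i ≤ B.length → j ≤ B.length → B.getVert i = B.getVert j → i = j := by
      intro i j hi hj h
      exact hBp.getVert_injOn hi hj h
    intro i j hi hj h
    rcases fcase i with rfl | ⟨s, hs, rfl⟩ | ⟨s, rfl⟩ <;>
    rcases fcase j with rfl | ⟨t, ht, rfl⟩ | ⟨t, rfl⟩
    · rfl
    · rw [f0, fW t ht] at h
      have := hWin t ht
      rw [← h] at this
      linarith
    · rw [f0, fB] at h
      have := binj t B.length (by omega) le_rfl (by rw [Walk.getVert_length]; exact h.symm)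
      omega
    · rw [f0, fW s hs] at h
      have := hWin s hs
      rw [h] at this
      linarith
    · rw [fW s hs, fW t ht] at h
      rcases le_total s t with hst | hst
      · rw [winj s t hst ht h]
      · rw [winj t s hst hs h.symm]
    · rw [fW s hs, fB] at h
      have h1 := hWin s hs
      have h2 := hBout t
      rw [h] at h1
      linarith
    · rw [f0, fB] at h
      have := binj s B.length (by omega) le_rfl (by rw [Walk.getVert_length]; exact h)
      omega
    · rw [fW t ht, fB] at h
      have h1 := hWin t ht
      have h2 := hBout s
      rw [h] at h2
      linarith
    · rw [fB, fB] at h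
      have := binj s t (by omega) (by omega) h
      omega)
  set L := K + 2 + B.length with hL
  obtain ⟨z, hcyc, g0, gW, gB⟩ : ∃ z, CycF G L z ∧ z 0 = α0 ∧
      (∀ i, i ≤ K → z (i + 1) = W.getVert i) ∧
      (∀ i, i ≤ B.length → z (K + 2 + i) = B.getVert i) := by
    refine ⟨_, hcyc, ?_, ?_, ?_⟩
    · beta_reduce; rw [hle 0 (by omega), f0]
    · intro i hi; beta_reduce; rw [hle _ (by omega), fW i hi]
    · intro i hi; beta_reduce; rw [hle _ (by omega), fB i]
  refine ⟨L, K + 2, z, δ + η, hcyc, by omega, by omega, by linarith, by linarith,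
    by push_cast; linarith, by push_cast; linarith, ?_, ?_, ?_, ?_, ?_⟩
  · intro i j hi hij hj
    obtain ⟨i, rfl⟩ : ∃ i', i = i' + 1 := ⟨i - 1, by omega⟩
    obtain ⟨j, rfl⟩ : ∃ i', j = i' + 1 := ⟨j - 1, by omega⟩
    rw [gW i (by omega), gW j (by omega), hgeo i j (by omega) (by omega)]
    push_cast; linarith
  · intro i hi hik
    obtain ⟨i, rfl⟩ : ∃ i', i = i' + 1 := ⟨i - 1, by omega⟩
    rw [gW i (by omega), g0]
    have e1 := hgeo i K (by omega) le_rfl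
    rw [hK, Walk.getVert_length] at e1
    have e2 : mgVDist G (W.getVert i) ⟨(β0, β1, θ), hYadj, hY0, hY1⟩ ≤ K - i + (1 - θ) := by
      have := mgVDist_lip hG (W.getVert i) β1 ⟨(β0, β1, θ), hYadj, hY0, hY1⟩
      linarith
    have e3 := via _ _ _ _ x0 e2
    push_cast
    linarith
  · intro i hi hik
    obtain ⟨i, rfl⟩ : ∃ i', i = i' + 1 := ⟨i - 1, by omega⟩
    have := gB 0 (by omega)
    rw [add_zero, Walk.getVert_zero] at this
    rw [gW i (by omega), this]
    have e1 := hgeo 0 i (by omega) (by omega)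
    rw [Walk.getVert_zero] at e1
    push_cast at e1
    have e2 : mgVDist G (W.getVert i) ⟨(α0, α1, η), hXadj, hX0, hX1⟩ ≤ i + (1 - η) := by
      have := mgVDist_lip hG (W.getVert i) α1 ⟨(α0, α1, η), hXadj, hX0, hX1⟩
      rw [SimpleGraph.dist_comm] at this
      linarith
    have e3 := via _ _ _ _ e2 y0
    rw [SimpleGraph.dist_comm] at e3
    push_cast
    linarith
  · have := gB 0 (by omega)
    rw [add_zero, Walk.getVert_zero] at this
    rw [this, g0]
    have e3 := via _ _ _ _ x0 y0
    push_cast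
    linarith
  · intro t i ht htL hi hik
    obtain ⟨i, rfl⟩ : ∃ i', i = i' + 1 := ⟨i - 1, by omega⟩
    obtain ⟨t, rfl⟩ : ∃ t', t = K + 2 + t' := ⟨t - (K + 2), by omega⟩
    rw [gW i (by omega), gB t (by omega)]
    have e1 := hBout t
    have e2 := mgVDist_lip hG (B.getVert t) (W.getVert i) p
    have e3 := hWf i (by omega)
    have e4 : ((i + 1 : ℕ) : ℝ) - (δ + η) = i - mgVDist G α1 p := by push_cast; linarith
    rw [e4]
    linarith

end extract


section chain
variable {V : Type} [Fintype V] [DecidableEq V] {G : SimpleGraph V}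

/-- `v` is connected to `α` through vertices at distance more than `δ` from `p`. -/
def OutConn (G : SimpleGraph V) (p : MGPoint G) (δ : ℝ) (α v : V) : Prop :=
  ∃ w : G.Walk v α, ∀ u ∈ w.support, δ < mgVDist G u p

/-- points whose edge is the base edge or touches the outer component of `α0`. -/
def Reach (G : SimpleGraph V) (p : MGPoint G) (δ : ℝ) (α0 α1 : V) (P : MGPoint G) : Prop :=
  (P.1.1 = α0 ∧ P.1.2.1 = α1) ∨ (P.1.1 = α1 ∧ P.1.2.1 = α0) ∨
    OutConn G p δ α0 P.1.1 ∨ OutConn G p δ α0 P.1.2.1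

lemma Reach.flip {p : MGPoint G} {δ : ℝ} {α0 α1 : V} {P : MGPoint G}
    (h : Reach G p δ α0 α1 P) : Reach G p δ α0 α1 (mgFlip P) := by
  rcases h with ⟨h1, h2⟩ | ⟨h1, h2⟩ | h | h
  · exact Or.inr (Or.inl ⟨h2, h1⟩)
  · exact Or.inl ⟨h2, h1⟩
  · exact Or.inr (Or.inr (Or.inr h))
  · exact Or.inr (Or.inr (Or.inl h))

lemma vdist_small (hG : G.Connected) (w : V) (Q : MGPoint G) (h : mgVDist G w Q < 1) :
    w = Q.1.1 ∨ w = Q.1.2.1 := by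
  have q1 := Q.2.2.1
  have q2 := Q.2.2.2
  rcases mgVDist_cases w Q with e | e
  · left
    have : (G.dist w Q.1.1 : ℝ) < 1 := by linarith
    have : G.dist w Q.1.1 < 1 := by exact_mod_cast this
    exact hG.dist_eq_zero_iff.1 (by omega)
  · right
    have : (G.dist w Q.1.2.1 : ℝ) < 1 := by linarith
    have : G.dist w Q.1.2.1 < 1 := by exact_mod_cast this
    exact hG.dist_eq_zero_iff.1 (by omega)

lemma reach_step (hG : G.Connected) {p : MGPoint G} {δ D ε : ℝ} {α0 α1 : V}
    (hdich : ∀ v, mgVDist G v p ≤ D ∨ δ < mgVDist G v p)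
    (hα1 : mgVDist G α1 p ≤ D) (hε : ε ≤ 1 / 2) (hεD : ε ≤ δ - D)
    (P Q : MGPoint G) (hP : δ ≤ mgDist G P p) (hPQ : mgDist G P Q < ε)
    (hR : Reach G p δ α0 α1 P) : Reach G p δ α0 α1 Q := by
  have aux : ∀ P : MGPoint G, δ ≤ mgDist G P p → mgDist G P Q < ε → Reach G p δ α0 α1 P →
      mgDist G P Q = P.1.2.2 + mgVDist G P.1.1 Q → Reach G p δ α0 α1 Q := by
    intro P hP hPQ hR e
    have s0 := P.2.2.1
    have v0 := mgVDist_nonneg P.1.1 Q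
    have hw := vdist_small hG P.1.1 Q (by linarith)
    have hf := mgDist_le_fst P p
    have hout : δ < mgVDist G P.1.1 p := by
      rcases hdich P.1.1 with h | h
      · linarith
      · exact h
    have hconn : OutConn G p δ α0 P.1.1 := by
      rcases hR with ⟨h1, h2⟩ | ⟨h1, h2⟩ | h | h
      · rw [h1] at hout ⊢
        exact ⟨Walk.nil, by simpa using hout⟩
      · rw [h1] at hout; linarith [hPQ, mgVDist_nonneg P.1.1 Q]
      · exact h
      · obtain ⟨w, hw⟩ := h
        refine ⟨Walk.cons P.2.1 w, ?_⟩
        intro u hu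
        rw [Walk.support_cons, List.mem_cons] at hu
        rcases hu with rfl | hu
        · exact hout
        · exact hw u hu
    rcases hw with h | h <;> rw [h] at hconn
    · exact Or.inr (Or.inr (Or.inl hconn))
    · exact Or.inr (Or.inr (Or.inr hconn))
  rcases mgDist_cases hG P Q with ⟨h1, h2, -⟩ | ⟨h1, h2, -⟩ | e | e
  · unfold Reach at hR ⊢
    rwa [h1, h2] at hR
  · have := hR.flip
    unfold Reach mgFlip at this
    unfold Reach
    simp only at this
    rwa [h1, h2] at this
  · exact aux P hP hPQ hR e
  · refine aux (mgFlip P) ?_ ?_ hR.flip ?_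
    · rwa [mgDist_flip_left]
    · rwa [mgDist_flip_left]
    · rw [mgDist_flip_left]; exact e

lemma propagate {p : MGPoint G} {δ ε : ℝ} (hε : 0 < ε) (R : MGPoint G → Prop)
    (hstep : ∀ P Q : MGPoint G, δ ≤ mgDist G P p → mgDist G P Q < ε → R P → R Q)
    {a b : ℝ} {γ : ℝ → MGPoint G} (hγ : IsMGGeodesic G a b γ) (u v : ℝ) (hu : u ∈ Icc a b)
    (hv : v ∈ Icc a b) (hfar : ∀ t, (u ≤ t ∧ t ≤ v) ∨ (v ≤ t ∧ t ≤ u) → δ ≤ mgDist G (γ t) p)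
    (hR : R (γ u)) : R (γ v) := by
  have main : ∀ m : ℕ, ∀ v ∈ Icc a b,
      (∀ t, (u ≤ t ∧ t ≤ v) ∨ (v ≤ t ∧ t ≤ u) → δ ≤ mgDist G (γ t) p) →
      |u - v| ≤ m * (ε / 2) → R (γ v) := by
    intro m
    induction m with
    | zero =>
      intro v hv hfar h
      have : |u - v| = 0 := le_antisymm (by simpa using h) (abs_nonneg _)
      have : u = v := by linarith [abs_eq_zero.1 this]
      rwa [← this]
    | succ m ih =>
      intro v hv hfar h
      push_cast at h
      set θ : ℝ := m / (m + 1) with hθ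
      have hm : (0:ℝ) ≤ m := by positivity
      have hθ0 : 0 ≤ θ := by positivity
      have hθm : θ * (m + 1) = m := by rw [hθ]; field_simp
      have hθ1 : θ ≤ 1 := by rw [hθ, div_le_one (by positivity)]; linarith
      set w := u + (v - u) * θ with hw
      have hwb : (u ≤ w ∧ w ≤ v) ∨ (v ≤ w ∧ w ≤ u) := by
        rcases le_total u v with h | h
        · left; constructor <;> nlinarith
        · right; constructor <;> nlinarith
      have hwI : w ∈ Icc a b := by
        rcases hwb with ⟨h1, h2⟩ | ⟨h1, h2⟩
        · exact ⟨hu.1.trans h1, h2.trans hv.2⟩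
        · exact ⟨hv.1.trans h1, h2.trans hu.2⟩
      have e1 : |u - w| = |u - v| * θ := by
        rw [show u - w = (u - v) * θ by rw [hw]; ring, abs_mul, abs_of_nonneg hθ0]
      have e2 : |w - v| = |u - v| * (1 - θ) := by
        rw [show w - v = (u - v) * (1 - θ) by rw [hw]; ring, abs_mul,
          abs_of_nonneg (by linarith : 0 ≤ 1 - θ)]
      have k1 : |u - w| ≤ m * (ε / 2) := by
        rw [e1]
        calc |u - v| * θ ≤ ((m + 1) * (ε / 2)) * θ := mul_le_mul_of_nonneg_right h hθ0
          _ = (θ * (m + 1)) * (ε / 2) := by ring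
          _ = _ := by rw [hθm]
      have k2 : |w - v| ≤ ε / 2 := by
        rw [e2]
        calc |u - v| * (1 - θ) ≤ ((m + 1) * (ε / 2)) * (1 - θ) :=
              mul_le_mul_of_nonneg_right h (by linarith)
          _ = (m + 1 - (θ * (m + 1))) * (ε / 2) := by ring
          _ = _ := by rw [hθm]; ring
      have hRw : R (γ w) := by
        refine ih w hwI (fun t ht => hfar t ?_) k1
        rcases hwb with ⟨h1, h2⟩ | ⟨h1, h2⟩ <;> rcases ht with ⟨h3, h4⟩ | ⟨h3, h4⟩
        · exact Or.inl ⟨h3, h4.trans h2⟩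
        · exact Or.inl ⟨h1.trans h3, h4.trans (h1.trans h2)⟩
        · exact Or.inr ⟨(h1.trans h2).trans h3, h4.trans h2⟩
        · exact Or.inr ⟨h1.trans h3, h4⟩
      refine hstep (γ w) (γ v) (hfar w hwb) ?_ hRw
      rw [hγ.2 w hwI v hv]
      linarith
  obtain ⟨m, hm⟩ := exists_nat_ge (|u - v| / (ε / 2))
  refine main m v hv hfar ?_
  rwa [div_le_iff₀ (by linarith)] at hm

/-- orient a point at distance `δ > 1` so that the second endpoint leads to `p`. -/
lemma orient (hG : G.Connected) (p X : MGPoint G) {δ : ℝ} (hδ : 1 < δ) (h : mgDist G X p = δ) :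
    ∃ X' : MGPoint G, (X' = X ∨ X' = mgFlip X) ∧
      δ = 1 - X'.1.2.2 + mgVDist G X'.1.2.1 p := by
  have x0 := X.2.2.1
  have x1 := X.2.2.2
  have p0 := p.2.2.1
  have p1 := p.2.2.2
  rcases mgDist_cases hG X p with ⟨-, -, e⟩ | ⟨-, -, e⟩ | e | e
  · exfalso
    have : |X.1.2.2 - p.1.2.2| ≤ 1 := by rw [abs_le]; constructor <;> linarith
    linarith
  · exfalso
    have : |X.1.2.2 - (1 - p.1.2.2)| ≤ 1 := by rw [abs_le]; constructor <;> linarith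
    linarith
  · refine ⟨mgFlip X, Or.inr rfl, ?_⟩
    simp only [mgFlip]
    linarith
  · exact ⟨X, Or.inl rfl, by linarith⟩

lemma exists_delta (p : MGPoint G) {D ε : ℝ} (hε : 0 < ε) :
    ∃ δ, D < δ ∧ δ ≤ D + ε ∧ ∀ v, mgVDist G v p ≤ D ∨ δ < mgVDist G v p := by
  have h1 : ∀ᶠ δ in nhdsWithin D (Ioi D), D < δ := eventually_mem_nhdsWithin
  have h2 : ∀ᶠ δ in nhdsWithin D (Ioi D), δ ≤ D + ε :=
    (eventually_le_nhds (by linarith : D < D + ε)).filter_mono nhdsWithin_le_nhds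
  have h3 : ∀ᶠ δ in nhdsWithin D (Ioi D), ∀ v, mgVDist G v p ≤ D ∨ δ < mgVDist G v p := by
    rw [Filter.eventually_all]
    intro v
    rcases le_or_gt (mgVDist G v p) D with h | h
    · exact Filter.Eventually.of_forall fun _ => Or.inl h
    · exact ((eventually_lt_nhds h).filter_mono nhdsWithin_le_nhds).mono fun _ => Or.inr
  obtain ⟨δ, ⟨a, b⟩, c⟩ := ((h1.and h2).and h3).exists
  exact ⟨δ, a, b, c⟩

lemma side_config (hG : G.Connected) {a1 b1 a2 b2 a3 b3 : ℝ} {γ1 γ2 γ3 : ℝ → MGPoint G}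
    (h1 : IsMGGeodesic G a1 b1 γ1) (h2 : IsMGGeodesic G a2 b2 γ2) (h3 : IsMGGeodesic G a3 b3 γ3)
    (k1 : mgDist G (γ1 b1) (γ2 a2) = 0) (k2 : mgDist G (γ2 b2) (γ3 a3) = 0)
    (k3 : mgDist G (γ3 b3) (γ1 a1) = 0) {D ε : ℝ} (hD : 1 ≤ D) (hε : 0 < ε) (s : ℝ)
    (hs : s ∈ Icc a1 b1) (f2 : ∀ t ∈ Icc a2 b2, D + ε < mgDist G (γ1 s) (γ2 t))
    (f3 : ∀ t ∈ Icc a3 b3, D + ε < mgDist G (γ1 s) (γ3 t)) :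
    ∃ δ, D < δ ∧ ∃ L k z x, Config G L k z x δ := by
  obtain ⟨δ, hDδ, hδε, hdich⟩ := exists_delta (γ1 s) (D := D) hε
  refine ⟨δ, hDδ, ?_⟩
  have far2 : ∀ t ∈ Icc a2 b2, δ ≤ mgDist G (γ2 t) (γ1 s) := by
    intro t ht; rw [mgDist_comm]; linarith [f2 t ht]
  have far3 : ∀ t ∈ Icc a3 b3, δ ≤ mgDist G (γ3 t) (γ1 s) := by
    intro t ht; rw [mgDist_comm]; linarith [f3 t ht]
  have hab := hs.1.trans hs.2
  have hs1 : δ < s - a1 := by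
    have e := h1.2 s hs a1 ⟨le_rfl, hab⟩
    rw [abs_of_nonneg (by linarith [hs.1])] at e
    have := f3 b3 ⟨h3.1, le_rfl⟩
    have t := mgDist_tri hG (γ1 s) (γ1 a1) (γ3 b3)
    rw [mgDist_comm (γ1 a1), k3] at t
    linarith
  have hs2 : δ < b1 - s := by
    have e := h1.2 s hs b1 ⟨hab, le_rfl⟩
    rw [abs_of_nonpos (by linarith [hs.2])] at e
    have := f2 a2 ⟨le_rfl, h2.1⟩
    have t := mgDist_tri hG (γ1 s) (γ1 b1) (γ2 a2)
    rw [k1] at t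
    linarith
  have far1 : ∀ t ∈ Icc a1 b1, (t ≤ s - δ ∨ s + δ ≤ t) → δ ≤ mgDist G (γ1 t) (γ1 s) := by
    intro t ht h
    rw [h1.2 t ht s hs, le_abs]
    rcases h with h | h
    · right; linarith
    · left; linarith
  have mX : s - δ ∈ Icc a1 b1 := ⟨by linarith, by linarith⟩
  have mY : s + δ ∈ Icc a1 b1 := ⟨by linarith, by linarith⟩
  have dX : mgDist G (γ1 (s - δ)) (γ1 s) = δ := by
    rw [h1.2 _ mX s hs, show s - δ - s = -δ by ring, abs_neg, abs_of_nonneg (by linarith)]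
  have dY : mgDist G (γ1 (s + δ)) (γ1 s) = δ := by
    rw [h1.2 _ mY s hs, show s + δ - s = δ by ring, abs_of_nonneg (by linarith)]
  have dXY : mgDist G (γ1 (s - δ)) (γ1 (s + δ)) = 2 * δ := by
    rw [h1.2 _ mX _ mY, show s - δ - (s + δ) = -(2 * δ) by ring, abs_neg,
      abs_of_nonneg (by linarith)]
  obtain ⟨X, hX, eX⟩ := orient hG (γ1 s) (γ1 (s - δ)) (by linarith) dX
  obtain ⟨Y, hY, eY⟩ := orient hG (γ1 s) (γ1 (s + δ)) (by linarith) dY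
  have dX' : mgDist G X (γ1 s) = δ := by
    rcases hX with rfl | rfl
    · exact dX
    · rwa [mgDist_flip_left]
  have dY' : mgDist G Y (γ1 s) = δ := by
    rcases hY with rfl | rfl
    · exact dY
    · rwa [mgDist_flip_left]
  have dXY' : mgDist G X Y = 2 * δ := by
    rcases hX with rfl | rfl <;> rcases hY with rfl | rfl <;>
      simpa only [mgDist_flip_left, mgDist_flip_right] using dXY
  have x0 := X.2.2.1
  have x1 := X.2.2.2
  have y0 := Y.2.2.1
  have y1 := Y.2.2.2
  have hα1 : mgVDist G X.1.2.1 (γ1 s) ≤ D := by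
    rcases hdich X.1.2.1 with h | h
    · exact h
    · linarith
  have hβ1 : mgVDist G Y.1.2.1 (γ1 s) ≤ D := by
    rcases hdich Y.1.2.1 with h | h
    · exact h
    · linarith
  set ε' := min (1 / 2) (δ - D) with hε'
  have hε0 : 0 < ε' := lt_min (by norm_num) (by linarith)
  have hstep := fun P Q => reach_step hG (p := γ1 s) (α0 := X.1.1) (α1 := X.1.2.1) hdich hα1
    (min_le_left _ _ : ε' ≤ 1 / 2) (min_le_right _ _) P Q
  have r0 : Reach G (γ1 s) δ X.1.1 X.1.2.1 (γ1 (s - δ)) := by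
    rcases hX with rfl | rfl
    · exact Or.inl ⟨rfl, rfl⟩
    · exact Or.inr (Or.inl ⟨rfl, rfl⟩)
  have r1 := propagate hε0 _ hstep h1 (s - δ) a1 mX ⟨le_rfl, hab⟩ (by
    rintro t (⟨u, v⟩ | ⟨u, v⟩)
    · exact far1 t ⟨by linarith, by linarith⟩ (Or.inl (by linarith))
    · exact far1 t ⟨u, by linarith⟩ (Or.inl v)) r0
  have r2 := hstep _ (γ3 b3) (far1 a1 ⟨le_rfl, hab⟩ (Or.inl (by linarith)))
    (by rw [mgDist_comm, k3]; exact hε0) r1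
  have r3 := propagate hε0 _ hstep h3 b3 a3 ⟨h3.1, le_rfl⟩ ⟨le_rfl, h3.1⟩ (by
    have := h3.1
    rintro t (⟨u, v⟩ | ⟨u, v⟩)
    · exact far3 t ⟨by linarith, by linarith⟩
    · exact far3 t ⟨u, v⟩) r2
  have r4 := hstep _ (γ2 b2) (far3 a3 ⟨le_rfl, h3.1⟩)
    (by rw [mgDist_comm, k2]; exact hε0) r3
  have r5 := propagate hε0 _ hstep h2 b2 a2 ⟨h2.1, le_rfl⟩ ⟨le_rfl, h2.1⟩ (by
    have := h2.1
    rintro t (⟨u, v⟩ | ⟨u, v⟩)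
    · exact far2 t ⟨by linarith, by linarith⟩
    · exact far2 t ⟨u, v⟩) r4
  have r6 := hstep _ (γ1 b1) (far2 a2 ⟨le_rfl, h2.1⟩)
    (by rw [mgDist_comm, k1]; exact hε0) r5
  have r7 := propagate hε0 _ hstep h1 b1 (s + δ) ⟨hab, le_rfl⟩ mY (by
    rintro t (⟨u, v⟩ | ⟨u, v⟩)
    · exact far1 t ⟨by linarith, by linarith⟩ (Or.inr (by linarith))
    · exact far1 t ⟨by linarith, v⟩ (Or.inr u)) r6
  have r8 : Reach G (γ1 s) δ X.1.1 X.1.2.1 Y := by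
    rcases hY with rfl | rfl
    · exact r7
    · exact r7.flip
  refine config_of hG (γ1 s) X Y δ D hD hDδ hdich eX eY dX' dY' dXY' ?_
  rcases r8 with ⟨e1, e2⟩ | ⟨e1, e2⟩ | h | ⟨w, hw⟩
  · exfalso
    have := mgDist_le_same X Y e1.symm e2.symm
    have h' : |X.1.2.2 - Y.1.2.2| ≤ 1 := by rw [abs_le]; constructor <;> linarith
    linarith
  · exfalso
    have := mgDist_le_opp X Y e2.symm e1.symm
    have h' : |X.1.2.2 - (1 - Y.1.2.2)| ≤ 1 := by rw [abs_le]; constructor <;> linarith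
    linarith
  · exact h
  · exfalso
    have := hw _ w.start_mem_support
    linarith

lemma triangle_bound (hG : G.Connected) {D : ℝ} (hD : 1 ≤ D)
    (hno : ∀ δ, D < δ → ¬ ∃ L k z x, Config G L k z x δ) (T : MGTriangle G) :
    triangleDelta T ≤ D := by
  refine le_of_forall_pos_le_add fun ε hε => ?_
  refine csInf_le ⟨0, fun d hd => hd.1⟩ ⟨by linarith, ?_, ?_, ?_⟩
  · intro s hs
    by_contra! h
    obtain ⟨f2, f3⟩ := h
    obtain ⟨δ, h1, h2⟩ := side_config hG T.h1 T.h2 T.h3 T.glue1 T.glue2 T.glue3 hD hε s hs f2 f3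
    exact hno δ h1 h2
  · intro s hs
    by_contra! h
    obtain ⟨f2, f3⟩ := h
    obtain ⟨δ, h1, h2⟩ := side_config hG T.h2 T.h3 T.h1 T.glue2 T.glue3 T.glue1 hD hε s hs f3 f2
    exact hno δ h1 h2
  · intro s hs
    by_contra! h
    obtain ⟨f2, f3⟩ := h
    obtain ⟨δ, h1, h2⟩ := side_config hG T.h3 T.h1 T.h2 T.glue3 T.glue1 T.glue2 hD hε s hs f2 f3
    exact hno δ h1 h2

lemma cycle_le_card {a : V} (w : G.Walk a a) (hw : w.IsCycle) : w.length ≤ Fintype.card V := by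
  obtain ⟨z, hz⟩ := exists_CycF w hw
  have := Fintype.card_le_of_injective (fun i : Fin w.length => z i) (by
    intro i j h
    exact Fin.ext (hz.inj i j i.2 j.2 h))
  simpa using this

lemma circ_bdd : BddAbove {n : ℕ | ∃ (a : V) (w : G.Walk a a), w.IsCycle ∧ w.length = n} :=
  ⟨Fintype.card V, by rintro n ⟨a, w, hw, rfl⟩; exact cycle_le_card w hw⟩

lemma le_circ {L : ℕ} {z : ℕ → V} (hz : CycF G L z) : L ≤ circumference G := by
  obtain ⟨a, w, hw, hl⟩ := hz.cycle
  exact le_csSup circ_bdd ⟨a, w, hw, hl⟩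

lemma exists_girth (h : 3 ≤ G.girth) : ∃ z, CycF G G.girth z := by
  have : ¬ G.IsAcyclic := by
    intro h'
    rw [SimpleGraph.girth_eq_zero.2 h'] at h
    omega
  obtain ⟨a, w, hw, hl⟩ := SimpleGraph.exists_girth_eq_length.2 this
  rw [hl]
  exact exists_CycF w hw

lemma exists_circ (h : 3 ≤ G.girth) : ∃ z, CycF G (circumference G) z := by
  obtain ⟨z, hz⟩ := exists_girth h
  obtain ⟨a, w, hw, hl⟩ := hz.cycle
  obtain ⟨a, w, hw, hl⟩ := Nat.sSup_mem
    (s := {n : ℕ | ∃ (a : V) (w : G.Walk a a), w.IsCycle ∧ w.length = n}) ⟨_, a, w, hw, hl⟩ circ_bdd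
  unfold circumference
  rw [← hl]
  exact exists_CycF w hw

lemma upper_triangle (hG : G.Connected) {g c a : ℕ} (hg : G.girth = g) (hc : circumference G = c)
    (h3 : 3 ≤ g) (hgc : g < c) (ha : 1 ≤ a) (hcard : Fintype.card V + 1 = c + a)
    (hag : 4 * a < g) (T : MGTriangle G) : triangleDelta T ≤ ((c : ℝ) - g + 4 * a) / 4 := by
  subst hg
  have ha' : (1:ℝ) ≤ a := by exact_mod_cast ha
  have hgc' : (G.girth:ℝ) + 1 ≤ c := by exact_mod_cast hgc
  obtain ⟨yg, hyg⟩ := exists_girth h3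
  obtain ⟨y, hy⟩ := exists_circ h3
  rw [hc] at hy
  refine triangle_bound hG (by linarith) ?_ T
  rintro δ hδ ⟨L, k, z, x, hC⟩
  have := config_bound hG hcard ha hag hgc (fun L z h => hc ▸ le_circ h) hy hyg hC
  linarith

lemma upper_hyp (hG : G.Connected) {g c a : ℕ} (hg : G.girth = g) (hc : circumference G = c)
    (h3 : 3 ≤ g) (hgc : g < c) (ha : 1 ≤ a) (hcard : Fintype.card V + 1 = c + a)
    (hag : 4 * a < g) : hypDelta G ≤ ((c : ℝ) - g + 4 * a) / 4 := by
  have hgc' : (g:ℝ) + 1 ≤ c := by exact_mod_cast hgc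
  refine Real.sSup_le ?_ (by
    have : (0:ℝ) ≤ a := by positivity
    linarith)
  rintro d ⟨T, rfl⟩
  exact upper_triangle hG hg hc h3 hgc ha hcard hag T

lemma adm_ineq {g c a : ℕ} (hg : G.girth = g) (hc : circumference G = c)
    (h3 : 3 ≤ g) (hgc : g < c) (ha : 1 ≤ a) (hcard : Fintype.card V + 1 = c + a)
    (hag : 4 * a < g) : 2 * g ≤ c + 2 * a := by
  subst hg
  obtain ⟨yg, hyg⟩ := exists_girth h3
  obtain ⟨y, hy⟩ := exists_circ h3
  rw [hc] at hy
  obtain ⟨i, j, r, he, i1, i2, j1, j2, h1, h2⟩ := exists_ear hy hyg hgc (by omega)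
  have main : ∀ i j, Ear G y c (y i) (y j) r → 1 ≤ i → i ≤ j → j ≤ c →
      2 * G.girth ≤ c + 2 * a := by
    intro i j he i1 hij j2
    have hne : i ≠ j := by
      rintro rfl
      obtain ⟨q, hq, -, e, he1, -⟩ := he
      rw [(Walk.isPath_iff_nil.1 hq).eq_nil] at he1
      simp at he1
    have e1 := ear_arc hy he hij (by omega)
    have e2 := ear_arc hy (i := j) (j := i + c) (by rw [hy.per]; exact he.symm) (by omega) (by omega)
    push_cast at e2
    have : (2 * G.girth : ℝ) ≤ c + 2 * r := by linarith
    have : 2 * G.girth ≤ c + 2 * r := by exact_mod_cast this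
    omega
  rcases le_total i j with h | h
  · exact main i j he i1 h j2
  · exact main j i he.symm j1 h i2

end chain


section theta

/-- Edge relation of the theta graph: a Hamiltonian path plus two chords. -/
def thetaE (b c n : ℕ) (i j : ℕ) : Prop :=
  j = i + 1 ∨ (i = 0 ∧ j + 1 = c) ∨ (i + 1 = b ∧ j + 1 = n)

/-- The theta graph with branches of lengths `a = n + 1 - c`, `b`, `c - b`. -/
def thetaG (b c n : ℕ) : SimpleGraph (Fin n) where
  Adj u v := u ≠ v ∧ (thetaE b c n u v ∨ thetaE b c n v u)
  symm := ⟨fun _ _ h => ⟨h.1.symm, h.2.symm⟩⟩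
  loopless := ⟨fun _ h => h.1 rfl⟩

lemma thetaG_adj {b c n : ℕ} (u v : Fin n) : (thetaG b c n).Adj u v ↔
    (u : ℕ) ≠ v ∧ (thetaE b c n u v ∨ thetaE b c n v u) := by
  simp [thetaG, Fin.ext_iff]

lemma thetaG_connected {b c n : ℕ} (hn : 0 < n) : (thetaG b c n).Connected := by
  haveI : Nonempty (Fin n) := ⟨⟨0, hn⟩⟩
  have h0 : ∀ k (hk : k < n), (thetaG b c n).Reachable ⟨0, hn⟩ ⟨k, hk⟩ := by
    intro k
    induction k with
    | zero => intro _; exact Reachable.refl _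
    | succ k ih =>
      intro hk
      refine (ih (by omega)).trans (Adj.reachable ?_)
      rw [thetaG_adj]
      exact ⟨by simp, Or.inl (Or.inl rfl)⟩
  refine ⟨fun u v => (h0 u u.2).symm.trans (h0 v v.2)⟩

lemma theta_cycF_c {b c n : ℕ} (h3 : 3 ≤ c) (hcn : c ≤ n) (d : ℕ) :
    CycF (thetaG b c n) c (fun t => ⟨(t + d) % c, (Nat.mod_lt _ (by omega)).trans_le hcn⟩) := by
  refine ⟨h3, ?_, ?_, ?_⟩
  · intro i
    rw [thetaG_adj]
    have hlt := Nat.mod_lt (i + d) (show 0 < c by omega)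
    have e : (i + 1 + d) % c = if (i + d) % c + 1 = c then 0 else (i + d) % c + 1 := by
      rw [show i + 1 + d = (i + d) + 1 by ring, Nat.add_mod, Nat.mod_eq_of_lt (show 1 < c by omega)]
      split_ifs with h
      · rw [h, Nat.mod_self]
      · rw [Nat.mod_eq_of_lt (by omega)]
    unfold thetaE
    simp only [e]
    split_ifs with h <;> omega
  · intro i
    simp [show i + c + d = (i + d) + c by ring]
  · intro i j hi hj h
    simp only [Fin.mk.injEq] at h
    have : i ≡ j [MOD c] := Nat.ModEq.add_right_cancel' d h
    exact this.eq_of_lt_of_lt hi hj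

lemma theta_cycF_g {a b c n : ℕ} (ha : 1 ≤ a) (hn : n + 1 = c + a) (hb : 3 * a + 1 ≤ b)
    (hbc : 2 * b ≤ c) : ∃ z, CycF (thetaG b c n) (a + b) z := by
  have := CycF_of (G := thetaG b c n) (L := a + b) (by omega)
    (fun i => if h : i < b then ⟨i, by omega⟩ else if h2 : i < a + b then
      ⟨n - 1 - (i - b), by omega⟩ else ⟨0, by omega⟩) (by
    intro i hi
    rw [thetaG_adj]
    unfold thetaE
    by_cases h1 : i + 1 < b
    · rw [dif_pos h1, dif_pos (by omega)]; simp
    · rw [dif_neg h1]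
      by_cases h2 : i < b
      · rw [dif_pos h2, dif_pos (by omega)]; simp; omega
      · rw [dif_neg h2, dif_pos hi]
        by_cases h3 : i + 1 < a + b
        · rw [dif_pos h3]; simp; omega
        · rw [dif_neg h3]; simp; omega) (by
    simp; omega) (by
    intro i j hi hj h
    simp only [hi, hj, dif_pos] at h
    by_cases h1 : i < b <;> by_cases h2 : j < b <;> simp [h1, h2] at h <;> omega)
  exact ⟨_, this.1⟩

/-- cyclic adjacency of vertex labels along a cycle. -/
def cAdj {n : ℕ} (z : ℕ → Fin n) (k x : ℕ) : Prop :=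
  ∃ i, ((z i : ℕ) = k ∧ (z (i + 1) : ℕ) = x) ∨ ((z i : ℕ) = x ∧ (z (i + 1) : ℕ) = k)

lemma cAdj.symm {n : ℕ} {z : ℕ → Fin n} {k x : ℕ} (h : cAdj z k x) : cAdj z x k := by
  obtain ⟨i, h | h⟩ := h
  · exact ⟨i, Or.inr h⟩
  · exact ⟨i, Or.inl h⟩

lemma cAdj_two {n L : ℕ} {G : SimpleGraph (Fin n)} {z : ℕ → Fin n} (hz : CycF G L z) {k : ℕ}
    (hk : ∃ i, (z i : ℕ) = k) : ∃ x y, x ≠ y ∧ ∀ w, cAdj z k w ↔ w = x ∨ w = y := by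
  obtain ⟨i, hi⟩ := hk
  have h3 := hz.three
  have e1 : z (i + L - 1 + 1) = z i := by
    rw [show i + L - 1 + 1 = i + L by omega, hz.per]
  refine ⟨z (i + 1), z (i + L - 1), ?_, ?_⟩
  · intro h
    have := (hz.eq_iff _ _).1 (Fin.ext h)
    have h2 := (Nat.modEq_iff_dvd' (by omega)).1 this
    rw [show i + L - 1 - (i + 1) = L - 2 by omega] at h2
    have := Nat.le_of_dvd (by omega) h2
    omega
  · intro w
    constructor
    · rintro ⟨j, ⟨h1, h2⟩ | ⟨h1, h2⟩⟩
      · left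
        have := (hz.eq_iff j i).1 (Fin.ext (h1.trans hi.symm))
        rw [← h2, (hz.eq_iff (j + 1) (i + 1)).2 (this.add_right 1)]
      · right
        have := (hz.eq_iff (j + 1) (i + L - 1 + 1)).1 (by
          rw [e1]; exact Fin.ext (h2.trans hi.symm))
        rw [← h1, (hz.eq_iff j (i + L - 1)).2 (this.add_right_cancel' 1)]
    · rintro (rfl | rfl)
      · exact ⟨i, Or.inl ⟨hi, rfl⟩⟩
      · exact ⟨i + L - 1, Or.inr ⟨rfl, by rw [e1, hi]⟩⟩

lemma spread (I : ℕ → Prop) (lo hi : ℕ) (hup : ∀ k, lo ≤ k → k < hi → I k → I (k + 1))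
    (hdn : ∀ k, lo < k → k ≤ hi → I k → I (k - 1)) (k : ℕ) (h1 : lo ≤ k) (h2 : k ≤ hi) (hk : I k) :
    ∀ j, lo ≤ j → j ≤ hi → I j := by
  have up : ∀ m, k + m ≤ hi → I (k + m) := by
    intro m
    induction m with
    | zero => intro _; exact hk
    | succ m ih => intro h; exact hup (k + m) (by omega) (by omega) (ih (by omega))
  have dn : ∀ m, lo + m ≤ k → I (k - m) := by
    intro m
    induction m with
    | zero => intro _; exact hk
    | succ m ih =>
      intro h
      have := hdn (k - m) (by omega) (by omega) (ih (by omega))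
      rwa [show k - (m + 1) = k - m - 1 by omega]
  intro j hj1 hj2
  rcases le_total k j with h | h
  · have := up (j - k) (by omega)
    rwa [show k + (j - k) = j by omega] at this
  · have := dn (k - j) (by omega)
    rwa [show k - (k - j) = j by omega] at this

set_option maxHeartbeats 2000000 in
lemma theta_len {a b c n L : ℕ} (ha : 1 ≤ a) (hn : n + 1 = c + a) (hb : 3 * a + 1 ≤ b)
    (hbc : 2 * b ≤ c) {z : ℕ → Fin n} (hz : CycF (thetaG b c n) L z) : a + b ≤ L ∧ L ≤ c := by
  have h3 := hz.three
  set I : ℕ → Prop := fun k => ∃ i, (z i : ℕ) = k with hI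
  have IA : ∀ k x, cAdj z k x → I k ∧ I x := by
    rintro k x ⟨i, ⟨h1, h2⟩ | ⟨h1, h2⟩⟩
    · exact ⟨⟨i, h1⟩, ⟨i + 1, h2⟩⟩
    · exact ⟨⟨i + 1, h2⟩, ⟨i, h1⟩⟩
  have In : ∀ k, I k → k < n := by
    rintro k ⟨i, rfl⟩; exact (z i).2
  have EA : ∀ k x, cAdj z k x → k ≠ x ∧ (thetaE b c n k x ∨ thetaE b c n x k) := by
    rintro k x ⟨i, ⟨h1, h2⟩ | ⟨h1, h2⟩⟩
    · have := (thetaG_adj _ _).1 (hz.adj i)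
      rwa [h1, h2] at this
    · have := (thetaG_adj _ _).1 (hz.adj i)
      rw [h1, h2] at this
      exact ⟨this.1.symm, this.2.symm⟩
  -- degree two vertices
  have deg2 : ∀ k p q, I k → (∀ w, w < n → k ≠ w → (thetaE b c n k w ∨ thetaE b c n w k) →
      w = p ∨ w = q) → cAdj z k p ∧ cAdj z k q := by
    intro k p q hk hw
    obtain ⟨x, y, hxy, hall⟩ := cAdj_two hz hk
    have hx := (hall x).2 (Or.inl rfl)
    have hy := (hall y).2 (Or.inr rfl)
    have ex := hw x (In _ (IA _ _ hx).2) (EA _ _ hx).1 (EA _ _ hx).2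
    have ey := hw y (In _ (IA _ _ hy).2) (EA _ _ hy).1 (EA _ _ hy).2
    rcases ex with rfl | rfl <;> rcases ey with rfl | rfl
    · exact absurd rfl hxy
    · exact ⟨hx, hy⟩
    · exact ⟨hy, hx⟩
    · exact absurd rfl hxy
  have dmid : ∀ k, I k → 0 < k → k + 1 < n → k + 1 ≠ b → k + 1 ≠ c →
      cAdj z k (k - 1) ∧ cAdj z k (k + 1) := by
    intro k hk h0 h1 h2 h4
    refine deg2 k _ _ hk ?_
    intro w hw hne h
    unfold thetaE at h
    omega
  have d0 : I 0 → cAdj z 0 1 ∧ cAdj z 0 (c - 1) := by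
    intro hk
    refine deg2 0 _ _ hk ?_
    intro w hw hne h
    unfold thetaE at h
    omega
  have dn : I (n - 1) → 2 ≤ a → cAdj z (n - 1) (n - 2) ∧ cAdj z (n - 1) (b - 1) := by
    intro hk h2
    refine deg2 (n - 1) _ _ hk ?_
    intro w hw hne h
    unfold thetaE at h
    omega
  -- paths
  have Pb : ∀ k, k + 2 ≤ b → I k → (∀ j, j + 2 ≤ b → I j) ∧ cAdj z (b - 1) (b - 2) ∧
      I (c - 1) := by
    intro k hkb hk
    have := spread I 0 (b - 2) ?_ ?_ k (by omega) (by omega) hk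
    · refine ⟨fun j hj => this j (by omega) (by omega), ?_,
        (IA _ _ (d0 (this 0 (by omega) (by omega))).2).2⟩
      have h := (dmid (b - 2) (this (b - 2) (by omega) le_rfl) (by omega) (by omega) (by omega)
        (by omega)).2.symm
      rwa [show b - 2 + 1 = b - 1 by omega] at h
    · intro k _ h hk
      rcases Nat.eq_zero_or_pos k with rfl | h0
      · exact (IA _ _ (d0 hk).1).2
      · exact (IA _ _ (dmid k hk h0 (by omega) (by omega) (by omega)).2).2
    · intro k h0 h hk
      exact (IA _ _ (dmid k hk h0 (by omega) (by omega) (by omega)).1).2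
  have Pl : ∀ k, b ≤ k → k + 2 ≤ c → I k → (∀ j, b ≤ j → j + 2 ≤ c → I j) ∧ cAdj z (b - 1) b ∧
      I (c - 1) := by
    intro k hkb hkc hk
    have := spread I b (c - 2) ?_ ?_ k (by omega) (by omega) hk
    · refine ⟨fun j hj hj2 => this j (by omega) (by omega), ?_, ?_⟩
      · exact (dmid b (this b (by omega) (by omega)) (by omega) (by omega) (by omega)
          (by omega)).1.symm
      · have h := (IA _ _ (dmid (c - 2) (this (c - 2) (by omega) (by omega)) (by omega) (by omega)
          (by omega) (by omega)).2).2
        rwa [show c - 2 + 1 = c - 1 by omega] at h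
    · intro k _ h hk
      exact (IA _ _ (dmid k hk (by omega) (by omega) (by omega) (by omega)).2).2
    · intro k h0 h hk
      exact (IA _ _ (dmid k hk (by omega) (by omega) (by omega) (by omega)).1).2
  have Pa : ∀ k, c ≤ k → I k → (∀ j, c ≤ j → j < n → I j) ∧ cAdj z (b - 1) (n - 1) ∧
      I (c - 1) := by
    intro k hkc hk
    have hkn := In k hk
    have step : ∀ k, c - 1 < k → k ≤ n - 1 → I k → I (k - 1) := by
      intro k h0 h hk
      by_cases h : k = n - 1
      · subst h
        exact (IA _ _ (dn hk (by omega)).1).2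
      · exact (IA _ _ (dmid k hk (by omega) (by omega) (by omega) (by omega)).1).2
    have := spread I c (n - 1) ?_ ?_ k (by omega) (by omega) hk
    · refine ⟨fun j hj hj2 => this j (by omega) (by omega), ?_, ?_⟩
      · exact (dn (this (n - 1) (by omega) (by omega)) (by omega)).2.symm
      · exact step c (by omega) (by omega) (this c (by omega) (by omega))
    · intro k _ h hk
      exact (IA _ _ (dmid k hk (by omega) (by omega) (by omega) (by omega)).2).2
    · intro k h0 h hk
      exact step k (by omega) h hk
  -- counting
  set T : Finset ℕ := (Finset.range L).image (fun i => (z i : ℕ)) with hT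
  have Tcard : T.card = L := by
    rw [hT, Finset.card_image_of_injOn, Finset.card_range]
    intro i hi j hj h
    simp only [Finset.coe_range, mem_Iio] at hi hj
    exact hz.inj i j hi hj (Fin.ext h)
  have Tmem : ∀ k, k ∈ T ↔ I k := by
    intro k
    simp only [hT, Finset.mem_image, Finset.mem_range, hI]
    constructor
    · rintro ⟨i, _, h⟩; exact ⟨i, h⟩
    · rintro ⟨i, h⟩
      exact ⟨i % L, Nat.mod_lt _ (by omega), by rw [hz.mod]; exact h⟩
  have cle : ∀ S : Finset ℕ, (∀ k, I k → k ∈ S) → L ≤ S.card := fun S h => by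
    rw [← Tcard]; exact Finset.card_le_card fun k hk => h k ((Tmem k).1 hk)
  have cge : ∀ S : Finset ℕ, (∀ k ∈ S, I k) → S.card ≤ L := fun S h => by
    rw [← Tcard]; exact Finset.card_le_card fun k hk => (Tmem k).2 (h k hk)
  have hcard2 : (Finset.range b ∪ Finset.Ico (c - 1) n).card = a + b := by
    rw [Finset.card_union_of_disjoint, Finset.card_range, Nat.card_Ico]
    · omega
    · rw [Finset.disjoint_left]
      intro k h1 h2
      simp only [Finset.mem_range, Finset.mem_Ico] at h1 h2
      omega
  constructor
  · -- lower bound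
    have hU : I (b - 1) := by
      obtain ⟨k, hk⟩ : ∃ k, I k := ⟨z 0, 0, rfl⟩
      have hkn := In k hk
      by_cases c1 : k + 2 ≤ b
      · exact (IA _ _ (Pb k c1 hk).2.1).1
      by_cases c2 : k + 1 = b
      · rwa [show b - 1 = k by omega]
      by_cases c3 : k + 2 ≤ c
      · exact (IA _ _ (Pl k (by omega) c3 hk).2.1).1
      by_cases c4 : c ≤ k
      · exact (IA _ _ (Pa k c4 hk).2.1).1
      have c5 : k = c - 1 := by omega
      obtain ⟨x, y, hxy, hall⟩ := cAdj_two hz hk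
      have hx := (hall x).2 (Or.inl rfl)
      have hy := (hall y).2 (Or.inr rfl)
      have key : ∀ w, cAdj z k w → w = 0 ∨ w = c - 2 → I (b - 1) := by
        rintro w hw (rfl | rfl)
        · exact (IA _ _ (Pb 0 (by omega) (IA _ _ hw).2).2.1).1
        · exact (IA _ _ (Pl (c - 2) (by omega) (by omega) (IA _ _ hw).2).2.1).1
      by_cases k1 : x = 0 ∨ x = c - 2
      · exact key x hx k1
      by_cases k2 : y = 0 ∨ y = c - 2
      · exact key y hy k2
      exfalso
      have ex := (EA _ _ hx).2
      have ey := (EA _ _ hy).2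
      have ix := In _ (IA _ _ hx).2
      have iy := In _ (IA _ _ hy).2
      unfold thetaE at ex ey
      omega
    obtain ⟨x, y, hxy, hall⟩ := cAdj_two hz hU
    have hx := (hall x).2 (Or.inl rfl)
    have hy := (hall y).2 (Or.inr rfl)
    have cl : ∀ w, cAdj z (b - 1) w → w = b - 2 ∨ w = b ∨ w = n - 1 := by
      intro w hw
      have ex := (EA _ _ hw).2
      have ix := In _ (IA _ _ hw).2
      unfold thetaE at ex
      omega
    have An : I (n - 1) → ∀ j, c - 1 ≤ j → j < n → I j := by
      intro h j h1 h2
      by_cases ha2 : a = 1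
      · rwa [show j = n - 1 by omega]
      · have := Pa (n - 1) (by omega) h
        by_cases h4 : j = c - 1
        · rw [h4]; exact this.2.2
        · exact this.1 j (by omega) h2
    have Bn : I (b - 2) → (∀ j, j < b → I j) ∧ I (c - 1) := by
      intro h
      have := Pb (b - 2) (by omega) h
      refine ⟨fun j hj => ?_, this.2.2⟩
      by_cases h4 : j = b - 1
      · rwa [h4]
      · exact this.1 j (by omega)
    have Ln : I b → (∀ j, b - 1 ≤ j → j < c → I j) := by
      intro h j h1 h2
      have := Pl b (by omega) (by omega) h
      by_cases h4 : j = b - 1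
      · rwa [h4]
      by_cases h5 : j = c - 1
      · rw [h5]; exact this.2.2
      · exact this.1 j (by omega) (by omega)
    have two : (I (b - 2) ∧ I b) ∨ (I (b - 2) ∧ I (n - 1)) ∨ (I b ∧ I (n - 1)) := by
      have ix := (IA _ _ hx).2
      have iy := (IA _ _ hy).2
      rcases cl x hx with h | h | h <;> rcases cl y hy with h' | h' | h' <;>
        rw [h] at ix <;> rw [h'] at iy <;> first
          | (exfalso; omega)
          | exact Or.inl ⟨ix, iy⟩
          | exact Or.inl ⟨iy, ix⟩
          | exact Or.inr (Or.inl ⟨ix, iy⟩)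
          | exact Or.inr (Or.inl ⟨iy, ix⟩)
          | exact Or.inr (Or.inr ⟨ix, iy⟩)
          | exact Or.inr (Or.inr ⟨iy, ix⟩)
    rcases two with ⟨h1, h2⟩ | ⟨h1, h2⟩ | ⟨h1, h2⟩
    · have := cge (Finset.range c) (by
        intro k hk
        rw [Finset.mem_range] at hk
        rcases Nat.lt_or_ge k b with h | h
        · exact (Bn h1).1 k h
        · exact Ln h2 k (by omega) hk)
      rw [Finset.card_range] at this
      omega
    · have := cge (Finset.range b ∪ Finset.Ico (c - 1) n) (by
        intro k hk
        simp only [Finset.mem_union, Finset.mem_range, Finset.mem_Ico] at hk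
        rcases hk with h | ⟨h, h'⟩
        · exact (Bn h1).1 k h
        · exact An h2 k h h')
      rwa [hcard2] at this
    · have := cge (Finset.Ico (b - 1) n) (by
        intro k hk
        simp only [Finset.mem_Ico] at hk
        rcases Nat.lt_or_ge k c with h | h
        · exact Ln h1 k hk.1 h
        · exact An h2 k (by omega) hk.2)
      rw [Nat.card_Ico] at this
      omega
  · -- upper bound
    by_cases hB : ∃ k, k + 2 ≤ b ∧ I k
    · by_cases hL : ∃ k, b ≤ k ∧ k + 2 ≤ c ∧ I k
      · by_cases hA : ∃ k, c ≤ k ∧ I k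
        · exfalso
          obtain ⟨k1, k2, k3⟩ := hB
          obtain ⟨l1, l2, l3, l4⟩ := hL
          obtain ⟨m1, m2, m3⟩ := hA
          have e1 := (Pb k1 k2 k3).2.1
          have e2 := (Pl l1 l2 l3 l4).2.1
          have e3 := (Pa m1 m2 m3).2.1
          have hm := In _ m3
          obtain ⟨x, y, hxy, hall⟩ := cAdj_two hz (IA _ _ e1).1
          have f1 := (hall _).1 e1
          have f2 := (hall _).1 e2
          have f3 := (hall _).1 e3
          omega
        · have := cle (Finset.range c) (by
            intro k hk
            rw [Finset.mem_range]
            by_contra h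
            exact hA ⟨k, by omega, hk⟩)
          rwa [Finset.card_range] at this
      · have := cle (Finset.range b ∪ Finset.Ico (c - 1) n) (by
          intro k hk
          simp only [Finset.mem_union, Finset.mem_range, Finset.mem_Ico]
          by_contra h
          have := In k hk
          exact hL ⟨k, by omega, by omega, hk⟩)
        rw [hcard2] at this
        omega
    · have := cle (Finset.Ico (b - 1) n) (by
        intro k hk
        simp only [Finset.mem_Ico]
        by_contra h
        have := In k hk
        exact hB ⟨k, by omega, hk⟩)
      rw [Nat.card_Ico] at this
      omega

lemma theta_girth {a b c n : ℕ} (ha : 1 ≤ a) (hn : n + 1 = c + a) (hb : 3 * a + 1 ≤ b)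
    (hbc : 2 * b ≤ c) : (thetaG b c n).girth = a + b := by
  obtain ⟨z, hz⟩ := theta_cycF_g ha hn hb hbc
  obtain ⟨v, w, hw, hl⟩ := hz.cycle
  have hna : ¬ (thetaG b c n).IsAcyclic := fun h => h w hw
  apply le_antisymm
  · rw [← hl]
    exact SimpleGraph.girth_le_length hw
  · obtain ⟨v, w, hw, hl⟩ := SimpleGraph.exists_girth_eq_length.2 hna
    obtain ⟨z, hz⟩ := exists_CycF w hw
    rw [hl]
    exact (theta_len ha hn hb hbc hz).1

lemma theta_circ {a b c n : ℕ} (ha : 1 ≤ a) (hn : n + 1 = c + a) (hb : 3 * a + 1 ≤ b)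
    (hbc : 2 * b ≤ c) : circumference (thetaG b c n) = c := by
  have hz := theta_cycF_c (b := b) (c := c) (n := n) (by omega) (by omega) 0
  refine le_antisymm ?_ (le_circ hz)
  obtain ⟨y, hy⟩ := exists_circ (G := thetaG b c n) (by
    rw [theta_girth ha hn hb hbc]; omega)
  exact (theta_len ha hn hb hbc hy).2

end theta


section metric

/-- integer cyclic distance -/
def nuZ (c i j : ℤ) : ℤ := min (max (i - j) (j - i)) (c - max (i - j) (j - i))

/-- real cyclic distance -/
noncomputable def nuR (c s t : ℝ) : ℝ := min |s - t| (c - |s - t|)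

lemma nuZ_cast (c i j : ℤ) : ((nuZ c i j : ℤ) : ℝ) = nuR c i j := by
  unfold nuZ nuR
  push_cast
  rw [abs_eq_max_neg, neg_sub]

lemma nuR_lip (c s t i j : ℝ) : nuR c s t ≤ |s - i| + nuR c i j + |j - t| := by
  unfold nuR
  have h1 : |s - t| ≤ |s - i| + |i - j| + |j - t| := by
    have := abs_sub_le s i t
    have := abs_sub_le i j t
    linarith
  have h2 : |i - j| ≤ |s - i| + |s - t| + |j - t| := by
    have e1 := abs_sub_le i s j
    have e2 := abs_sub_le s t j
    rw [abs_sub_comm i s] at e1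
    rw [abs_sub_comm t j] at e2
    linarith
  rcases min_choice |i - j| (c - |i - j|) with h | h <;> rw [h]
  · exact (min_le_left _ _).trans h1
  · refine (min_le_right _ _).trans ?_
    linarith

/-- lower bound for distances in the theta graph -/
noncomputable def mR (a c U W s t : ℝ) : ℝ :=
  min (nuR c s t) (min (nuR c s U + a + nuR c t W) (nuR c s W + a + nuR c t U))

lemma mR_lip (a c U W s t i j : ℝ) : mR a c U W s t ≤ |s - i| + mR a c U W i j + |j - t| := by
  unfold mR
  have l1 := nuR_lip c s t i j
  have l2 := nuR_lip c s U i U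
  have l3 := nuR_lip c s W i W
  have l4 := nuR_lip c t U j U
  have l5 := nuR_lip c t W j W
  rw [sub_self, abs_zero] at l2 l3 l4 l5
  rw [abs_sub_comm t j] at l4 l5
  rcases min_choice (nuR c i j) (min (nuR c i U + a + nuR c j W) (nuR c i W + a + nuR c j U))
    with h | h <;> rw [h]
  · exact (min_le_left _ _).trans l1
  · refine (min_le_right _ _).trans ?_
    rcases min_choice (nuR c i U + a + nuR c j W) (nuR c i W + a + nuR c j U) with h | h <;> rw [h]
    · refine (min_le_left _ _).trans ?_
      linarith
    · refine (min_le_right _ _).trans ?_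
      linarith

/-- Integer potential on labels of the cycle. -/
def hcyc (a b c s v : ℤ) : ℤ :=
  min (nuZ c s v) (min (nuZ c s (b - 1) + a + nuZ c v (c - 1)) (nuZ c s (c - 1) + a + nuZ c v (b - 1)))

/-- Integer potential on all labels. -/
def hpot (a b c s v : ℤ) : ℤ :=
  if v < c then hcyc a b c s v
  else min (hcyc a b c s (c - 1) + (v - (c - 1))) (hcyc a b c s (b - 1) + (c + a - 1 - v))

lemma nuZ_nonneg {c i j : ℤ} (hi : 0 ≤ i) (hj : 0 ≤ j) (hi' : i < c) (hj' : j < c) :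
    0 ≤ nuZ c i j := by
  unfold nuZ; omega

lemma nuZ_succ (c i j : ℤ) : nuZ c i (j + 1) ≤ nuZ c i j + 1 ∧ nuZ c i j ≤ nuZ c i (j + 1) + 1 := by
  unfold nuZ; omega

lemma nuZ_succ' (c i j : ℤ) : nuZ c (j + 1) i ≤ nuZ c j i + 1 ∧ nuZ c j i ≤ nuZ c (j + 1) i + 1 := by
  unfold nuZ; omega

lemma nuZ_wrap {c i : ℤ} (hi : 0 ≤ i) (hi' : i < c) :
    nuZ c i 0 ≤ nuZ c i (c - 1) + 1 ∧ nuZ c i (c - 1) ≤ nuZ c i 0 + 1 := by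
  unfold nuZ; omega

lemma nuZ_comm (c i j : ℤ) : nuZ c i j = nuZ c j i := by
  unfold nuZ; omega

lemma hcyc_U {a b c s : ℤ} (ha : 0 ≤ a) (hb : 1 ≤ b) (hbc : b < c) (hs : 0 ≤ s) (hs' : s < c) :
    hcyc a b c s (b - 1) = min (nuZ c s (b - 1)) (nuZ c s (c - 1) + a) := by
  have h1 : nuZ c (b - 1) (b - 1) = 0 := by unfold nuZ; omega
  have h2 := nuZ_nonneg (c := c) (i := b - 1) (j := c - 1) (by omega) (by omega) (by omega) (by omega)
  unfold hcyc
  rw [h1]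
  omega

lemma hcyc_W {a b c s : ℤ} (ha : 0 ≤ a) (hb : 1 ≤ b) (hbc : b < c) (hs : 0 ≤ s) (hs' : s < c) :
    hcyc a b c s (c - 1) = min (nuZ c s (c - 1)) (nuZ c s (b - 1) + a) := by
  have h1 : nuZ c (c - 1) (c - 1) = 0 := by unfold nuZ; omega
  have h2 := nuZ_nonneg (c := c) (i := c - 1) (j := b - 1) (by omega) (by omega) (by omega) (by omega)
  unfold hcyc
  rw [h1]
  omega

lemma hcyc_succ (a b c s v : ℤ) : hcyc a b c s (v + 1) ≤ hcyc a b c s v + 1 ∧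
    hcyc a b c s v ≤ hcyc a b c s (v + 1) + 1 := by
  have l1 := nuZ_succ c s v
  have l2 := nuZ_succ' c (c - 1) v
  have l3 := nuZ_succ' c (b - 1) v
  unfold hcyc
  omega

lemma hcyc_wrap {a b c s : ℤ} (hb : 1 ≤ b) (hbc : b < c) (hs : 0 ≤ s) (hs' : s < c) :
    hcyc a b c s (c - 1) ≤ hcyc a b c s 0 + 1 ∧ hcyc a b c s 0 ≤ hcyc a b c s (c - 1) + 1 := by
  have l1 := nuZ_wrap hs hs'
  have l2 := nuZ_wrap (c := c) (i := c - 1) (by omega) (by omega)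
  have l3 := nuZ_wrap (c := c) (i := b - 1) (by omega) (by omega)
  unfold hcyc
  rw [nuZ_comm c 0, nuZ_comm c 0, nuZ_comm c (c - 1) (b - 1)]
  omega

lemma hpot_lip {a b c n : ℕ} (ha : 1 ≤ a) (hn : n + 1 = c + a) (hb : 3 * a + 1 ≤ b)
    (hbc : 2 * b ≤ c) {s : ℤ} (hs : 0 ≤ s) (hs' : s < c) {u v : ℕ} (hu : u < n) (hv : v < n)
    (h : thetaE b c n u v) : hpot a b c s u ≤ hpot a b c s v + 1 ∧ hpot a b c s v ≤ hpot a b c s u + 1 := by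
  have eU := hcyc_U (a := a) (b := b) (c := c) (s := s) (by omega) (by omega) (by omega) hs hs'
  have eW := hcyc_W (a := a) (b := b) (c := c) (s := s) (by omega) (by omega) (by omega) hs hs'
  have hUW : hcyc a b c s (b - 1) ≤ hcyc a b c s (c - 1) + a ∧
      hcyc a b c s (c - 1) ≤ hcyc a b c s (b - 1) + a := by
    rw [eU, eW]; omega
  rcases h with rfl | ⟨rfl, h⟩ | ⟨h1, h2⟩
  · by_cases h1 : u + 1 < c
    · unfold hpot
      rw [if_pos (by omega), if_pos (by omega)]
      have := hcyc_succ a b c s u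
      push_cast
      omega
    · by_cases h2 : u < c
      · unfold hpot
        have : (u : ℤ) = c - 1 := by omega
        rw [if_pos (by omega), if_neg (by omega)]
        push_cast
        rw [this]
        omega
      · unfold hpot
        rw [if_neg (by omega), if_neg (by omega)]
        push_cast
        omega
  · have := hcyc_wrap (a := a) (b := b) (c := c) (s := s) (by omega) (by omega) hs hs'
    unfold hpot
    rw [if_pos (by omega), if_pos (by omega), show (v : ℤ) = c - 1 by omega]
    push_cast
    omega
  · unfold hpot
    rw [if_pos (by omega), show (u : ℤ) = b - 1 by omega]
    by_cases h3 : v < c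
    · rw [if_pos (by omega), show (v : ℤ) = c - 1 by omega]
      omega
    · rw [if_neg (by omega)]
      omega

lemma dist_of_lip {V : Type} {G : SimpleGraph V} (hG : G.Connected) (h : V → ℤ)
    (hl : ∀ u v, G.Adj u v → h v ≤ h u + 1) (u v : V) : h v ≤ h u + G.dist u v := by
  obtain ⟨w, hw⟩ := hG.exists_walk_length_eq_dist u v
  rw [← hw]
  clear hw
  induction w with
  | nil => simp
  | cons h1 p ih =>
    have := hl _ _ h1
    rw [Walk.length_cons]
    push_cast
    linarith

lemma theta_dist_label {a b c n : ℕ} (ha : 1 ≤ a) (hn : n + 1 = c + a) (hb : 3 * a + 1 ≤ b)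
    (hbc : 2 * b ≤ c) (u v : Fin n) (hu : (u : ℕ) < c) (hv : (v : ℕ) < c) :
    hcyc a b c (u : ℕ) (v : ℕ) ≤ (thetaG b c n).dist u v := by
  have := dist_of_lip (thetaG_connected (b := b) (c := c) (n := n) (by omega))
    (fun x => hpot a b c (u : ℕ) (x : ℕ)) (by
      intro x y hxy
      have hs : (0:ℤ) ≤ (u : ℕ) := by omega
      have hs' : ((u : ℕ) : ℤ) < c := by omega
      rcases ((thetaG_adj _ _).1 hxy).2 with h | h
      · exact (hpot_lip ha hn hb hbc hs hs' x.2 y.2 h).2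
      · exact (hpot_lip ha hn hb hbc hs hs' y.2 x.2 h).1) u v
  beta_reduce at this
  unfold hpot at this
  rw [if_pos (by omega), if_pos (by omega)] at this
  have h0 : hcyc a b c (u : ℕ) (u : ℕ) ≤ 0 := by
    unfold hcyc nuZ
    omega
  linarith

lemma nuZ_shift {c x y k x' y' : ℤ} (hx : x' = x + k ∨ x' = x + k - c) (hy : y' = y + k ∨ y' = y + k - c)
    (hx0 : 0 ≤ x') (hxc : x' < c) (hy0 : 0 ≤ y') (hyc : y' < c) : nuZ c x y ≤ nuZ c x' y' := by
  unfold nuZ; omega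

lemma theta_dist_pos {a b c n : ℕ} (ha : 1 ≤ a) (hn : n + 1 = c + a) (hb : 3 * a + 1 ≤ b)
    (hbc : 2 * b ≤ c) (u v : Fin n) (i j : ℕ) (hi : i ≤ c + 1) (hj : j ≤ c + 1)
    (hu : (u : ℕ) = (i + (a - 1)) % c) (hv : (v : ℕ) = (j + (a - 1)) % c) :
    mR a c (b - a) (c - a) i j ≤ (thetaG b c n).dist u v := by
  have hu' : (u : ℕ) < c := by rw [hu]; exact Nat.mod_lt _ (by omega)
  have hv' : (v : ℕ) < c := by rw [hv]; exact Nat.mod_lt _ (by omega)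
  have h := theta_dist_label ha hn hb hbc u v hu' hv'
  have hmod : ∀ i k : ℕ, i ≤ c + 1 → k = (i + (a - 1)) % c →
      ((k : ℤ) = i + (a - 1) ∨ (k : ℤ) = i + (a - 1) - c) := by
    intro i k hi hk
    rcases Nat.lt_or_ge (i + (a - 1)) c with h | h
    · rw [Nat.mod_eq_of_lt h] at hk; omega
    · rw [Nat.mod_eq_sub_mod h, Nat.mod_eq_of_lt (by omega)] at hk; omega
  have eu := hmod i u hi hu
  have ev := hmod j v hj hv
  have l1 := nuZ_shift (c := c) (x := i) (y := j) eu ev (by omega) (by omega) (by omega) (by omega)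
  have l2 := nuZ_shift (c := c) (x := i) (y := b - a) (y' := b - 1) eu (by omega) (by omega) (by omega) (by omega) (by omega)
  have l3 := nuZ_shift (c := c) (x := i) (y := c - a) (y' := c - 1) eu (by omega) (by omega) (by omega) (by omega) (by omega)
  have l4 := nuZ_shift (c := c) (x := j) (y := b - a) (y' := b - 1) ev (by omega) (by omega) (by omega) (by omega) (by omega)
  have l5 := nuZ_shift (c := c) (x := j) (y := c - a) (y' := c - 1) ev (by omega) (by omega) (by omega) (by omega) (by omega)
  have key : min (nuZ c i j) (min (nuZ c i (b - a) + a + nuZ c j (c - a))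
      (nuZ c i (c - a) + a + nuZ c j (b - a))) ≤ (thetaG b c n).dist u v := by
    unfold hcyc at h
    omega
  have key' : ((min (nuZ c i j) (min (nuZ c i (b - a) + a + nuZ c j (c - a))
      (nuZ c i (c - a) + a + nuZ c j (b - a))) : ℤ) : ℝ) ≤ (((thetaG b c n).dist u v : ℤ) : ℝ) :=
    Int.cast_le.2 key
  push_cast [nuZ_cast] at key'
  unfold mR
  exact key'

end metric


section lower

/-- The point at position `τ` along a parametrised cycle. -/
noncomputable def cycPt {V : Type} {G : SimpleGraph V} {L : ℕ} {z : ℕ → V} (hz : CycF G L z)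
    (τ : ℝ) : MGPoint G :=
  ⟨(z ⌊τ⌋₊, z (⌊τ⌋₊ + 1), Int.fract τ), hz.adj _, Int.fract_nonneg τ, (Int.fract_lt_one τ).le⟩

lemma fract_nat {τ : ℝ} (h : 0 ≤ τ) : Int.fract τ = τ - (⌊τ⌋₊ : ℝ) := by
  rw [Int.fract, ← natCast_floor_eq_intCast_floor h]

variable {V : Type} [Fintype V] [DecidableEq V] {G : SimpleGraph V}

lemma mgDist_nonneg (hG : G.Connected) (P Q : MGPoint G) : 0 ≤ mgDist G P Q := by
  have p0 := P.2.2.1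
  have p1 := P.2.2.2
  have v0 := mgVDist_nonneg P.1.1 Q
  have v1 := mgVDist_nonneg P.1.2.1 Q
  rcases mgDist_cases hG P Q with ⟨_, _, e⟩ | ⟨_, _, e⟩ | e | e <;> rw [e]
  · exact abs_nonneg _
  · exact abs_nonneg _
  · linarith
  · linarith

lemma cycPt_le (hG : G.Connected) {L : ℕ} {z : ℕ → V} (hz : CycF G L z) {s t : ℝ} (hs : 0 ≤ s)
    (ht : 0 ≤ t) : mgDist G (cycPt hz s) (cycPt hz t) ≤ |s - t| := by
  have main : ∀ s t : ℝ, 0 ≤ s → s ≤ t → mgDist G (cycPt hz s) (cycPt hz t) ≤ |s - t| := by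
    intro s t hs hst
    have es := fract_nat hs
    have et := fract_nat (hs.trans hst)
    rcases (Nat.floor_le_floor hst).eq_or_lt with h | h
    · have := mgDist_le_same (cycPt hz s) (cycPt hz t) (by simp [cycPt, h]) (by simp [cycPt, h])
      refine this.trans (le_of_eq ?_)
      simp only [cycPt]
      rw [es, et, h]
      congr 1
      ring
    · have h1 := mgDist_le_snd (cycPt hz s) (cycPt hz t)
      have h2 := mgVDist_le_fst (cycPt hz s).1.2.1 (cycPt hz t)
      simp only [cycPt] at h1 h2
      have h3 := hz.dist_le (⌊s⌋₊ + 1) ⌊t⌋₊ h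
      rw [abs_of_nonpos (by linarith)]
      push_cast at h3
      simp only [cycPt]
      linarith
  rcases le_total s t with h | h
  · exact main s t hs h
  · rw [mgDist_comm, abs_sub_comm]
    exact main t s ht h

lemma cycPt_ge (hG : G.Connected) {L : ℕ} {z : ℕ → V} (hz : CycF G L z) (m : ℝ → ℝ → ℝ)
    (hlip : ∀ s t i j, m s t ≤ |s - i| + m i j + |j - t|)
    (hwrap : ∀ s t, m s t ≤ |s - t| ∧ m s t ≤ L - |s - t|)
    (hd : ∀ i j : ℕ, i ≤ L + 1 → j ≤ L + 1 → m i j ≤ G.dist (z i) (z j)) {s t : ℝ} (hs : 0 ≤ s)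
    (ht : 0 ≤ t) (hsL : s ≤ L) (htL : t ≤ L) : m s t ≤ mgDist G (cycPt hz s) (cycPt hz t) := by
  have h3 := hz.three
  have es := fract_nat hs
  have et := fract_nat ht
  have fs : ⌊s⌋₊ ≤ L := Nat.floor_le_of_le hsL
  have ft : ⌊t⌋₊ ≤ L := Nat.floor_le_of_le htL
  have s1 := Nat.floor_le hs
  have t1 := Nat.floor_le ht
  have s2 := Nat.lt_floor_add_one s
  have t2 := Nat.lt_floor_add_one t
  have as1 : |s - (⌊s⌋₊ : ℝ)| = s - ⌊s⌋₊ := abs_of_nonneg (by linarith)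
  have as2 : |s - ((⌊s⌋₊ + 1 : ℕ) : ℝ)| = 1 - (s - ⌊s⌋₊) := by
    push_cast
    rw [abs_of_nonpos (by linarith)]; ring
  have at1 : |(⌊t⌋₊ : ℝ) - t| = t - ⌊t⌋₊ := by rw [abs_of_nonpos (by linarith)]; ring
  have at2 : |((⌊t⌋₊ + 1 : ℕ) : ℝ) - t| = 1 - (t - ⌊t⌋₊) := by
    push_cast
    rw [abs_of_nonneg (by linarith)]; ring
  rcases mgDist_cases hG (cycPt hz s) (cycPt hz t) with ⟨e1, e2, e⟩ | ⟨e1, e2, e⟩ | e | e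
  · rw [e]
    simp only [cycPt] at e1 ⊢
    rw [es, et]
    have hm := (hz.eq_iff _ _).1 e1
    rcases Nat.lt_or_ge ⌊s⌋₊ L with k1 | k1 <;> rcases Nat.lt_or_ge ⌊t⌋₊ L with k2 | k2
    · have := hm.eq_of_lt_of_lt k1 k2
      rw [this, show s - (⌊t⌋₊ : ℝ) - (t - ⌊t⌋₊) = s - t by ring]
      exact (hwrap s t).1
    · have k3 : ⌊t⌋₊ = L := le_antisymm ft k2
      have k4 : ⌊s⌋₊ = 0 := by
        rw [k3] at hm
        have : ⌊s⌋₊ % L = L % L := hm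
        rwa [Nat.mod_eq_of_lt k1, Nat.mod_self] at this
      rw [k3] at t1
      have : t = L := le_antisymm htL t1
      have h := (hwrap s t).2
      rw [k3, k4, this]
      rw [this, abs_of_nonpos (by linarith)] at h
      refine h.trans (le_trans (le_of_eq ?_) (le_abs_self _))
      push_cast; ring
    · have k3 : ⌊s⌋₊ = L := le_antisymm fs k1
      have k4 : ⌊t⌋₊ = 0 := by
        rw [k3] at hm
        have : L % L = ⌊t⌋₊ % L := hm
        rw [Nat.mod_eq_of_lt k2, Nat.mod_self] at this
        exact this.symm
      rw [k3] at s1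
      have : s = L := le_antisymm hsL s1
      have h := (hwrap s t).2
      rw [k3, k4, this]
      rw [this, abs_of_nonneg (by linarith)] at h
      refine h.trans (le_trans (le_of_eq ?_) (neg_le_abs _))
      push_cast; ring
    · rw [le_antisymm fs k1, le_antisymm ft k2, show s - (L : ℝ) - (t - L) = s - t by ring]
      exact (hwrap s t).1
  · exfalso
    simp only [cycPt] at e1 e2
    have m1 := (hz.eq_iff _ _).1 e1
    have m2 := (hz.eq_iff _ _).1 e2
    have m3 : ⌊t⌋₊ + 1 + 1 ≡ ⌊t⌋₊ [MOD L] := (m1.symm.add_right 1).trans m2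
    have := (Nat.modEq_iff_dvd' (by omega)).1 m3.symm
    rw [show ⌊t⌋₊ + 1 + 1 - ⌊t⌋₊ = 2 by omega] at this
    have := Nat.le_of_dvd (by omega) this
    omega
  · rw [e]
    rcases mgVDist_cases (cycPt hz s).1.1 (cycPt hz t) with e' | e' <;> rw [e'] <;>
      simp only [cycPt] <;> rw [es, et]
    · have h1 := hlip s t ⌊s⌋₊ ⌊t⌋₊
      have h2 := hd ⌊s⌋₊ ⌊t⌋₊ (by omega) (by omega)
      linarith
    · have h1 := hlip s t ⌊s⌋₊ (⌊t⌋₊ + 1 : ℕ)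
      have h2 := hd ⌊s⌋₊ (⌊t⌋₊ + 1) (by omega) (by omega)
      linarith
  · rw [e]
    rcases mgVDist_cases (cycPt hz s).1.2.1 (cycPt hz t) with e' | e' <;> rw [e'] <;>
      simp only [cycPt] <;> rw [es, et]
    · have h1 := hlip s t (⌊s⌋₊ + 1 : ℕ) ⌊t⌋₊
      have h2 := hd (⌊s⌋₊ + 1) ⌊t⌋₊ (by omega) (by omega)
      linarith
    · have h1 := hlip s t (⌊s⌋₊ + 1 : ℕ) (⌊t⌋₊ + 1 : ℕ)
      have h2 := hd (⌊s⌋₊ + 1) (⌊t⌋₊ + 1) (by omega) (by omega)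
      linarith

lemma le_nuR {c s t r : ℝ} (h1 : r ≤ |s - t|) (h2 : |s - t| ≤ c - r) : r ≤ nuR c s t :=
  le_min h1 (by linarith)

lemma abs_split {x : ℝ} : (0 ≤ x ∧ |x| = x) ∨ (x ≤ 0 ∧ |x| = -x) := by
  rcases le_total 0 x with h | h
  · exact Or.inl ⟨h, abs_of_nonneg h⟩
  · exact Or.inr ⟨h, abs_of_nonpos h⟩

lemma nuR_cases (c s t : ℝ) : nuR c s t = s - t ∨ nuR c s t = t - s ∨ nuR c s t = c - (s - t) ∨
    nuR c s t = c - (t - s) := by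
  unfold nuR
  rcases min_choice |s - t| (c - |s - t|) with h | h <;> rw [h] <;>
    rcases abs_split (x := s - t) with ⟨_, h⟩ | ⟨_, h⟩ <;> rw [h]
  · left; rfl
  · right; left; ring
  · right; right; left; rfl
  · right; right; right; ring

/-- Branching of the real cyclic distance with sign information. -/
lemma nuR_split (c s t : ℝ) : (nuR c s t = s - t ∧ t ≤ s) ∨ (nuR c s t = t - s ∧ s ≤ t) ∨
    (nuR c s t = c - (s - t) ∧ t ≤ s) ∨ (nuR c s t = c - (t - s) ∧ s ≤ t) := by
  unfold nuR
  rcases min_choice |s - t| (c - |s - t|) with h | h <;> rw [h] <;>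
    rcases abs_split (x := s - t) with ⟨h', h⟩ | ⟨h', h⟩ <;> rw [h]
  · exact Or.inl ⟨rfl, by linarith⟩
  · exact Or.inr (Or.inl ⟨by ring, by linarith⟩)
  · exact Or.inr (Or.inr (Or.inl ⟨rfl, by linarith⟩))
  · exact Or.inr (Or.inr (Or.inr ⟨by ring, by linarith⟩))

lemma le_mR {a c U W s t r : ℝ} (h1 : r ≤ nuR c s t) (h2 : r ≤ nuR c s U + a + nuR c t W)
    (h3 : r ≤ nuR c s W + a + nuR c t U) : r ≤ mR a c U W s t :=
  le_min h1 (le_min h2 h3)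

/-- along the sides, `mR` is at least the parameter difference -/
lemma side_mR {a b c s t : ℝ} (ha : 1 ≤ a) (hb : 3 * a + 1 ≤ b) (hbc : 2 * b ≤ c) (h0 : 0 ≤ s)
    (hst : s ≤ t) (htc : t ≤ c)
    (h : t ≤ (b - a) / 2 ∨ ((b - a) / 2 ≤ s ∧ t ≤ (b - a) + (c - b - a) / 2) ∨
      (b - a) + (c - b - a) / 2 ≤ s) :
    t - s ≤ mR a c (b - a) (c - a) s t := by
  refine le_mR ?_ ?_ ?_
  · rcases h with h | ⟨h, h'⟩ | h <;>
    rcases nuR_split c s t with ⟨e, i⟩ | ⟨e, i⟩ | ⟨e, i⟩ | ⟨e, i⟩ <;> rw [e] <;> linarith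
  · rcases h with h | ⟨h, h'⟩ | h <;>
    rcases nuR_split c s (b - a) with ⟨e, i⟩ | ⟨e, i⟩ | ⟨e, i⟩ | ⟨e, i⟩ <;> rw [e] <;>
    rcases nuR_split c t (c - a) with ⟨e, i⟩ | ⟨e, i⟩ | ⟨e, i⟩ | ⟨e, i⟩ <;> rw [e] <;> linarith
  · rcases h with h | ⟨h, h'⟩ | h <;>
    rcases nuR_split c s (c - a) with ⟨e, i⟩ | ⟨e, i⟩ | ⟨e, i⟩ | ⟨e, i⟩ <;> rw [e] <;>
    rcases nuR_split c t (b - a) with ⟨e, i⟩ | ⟨e, i⟩ | ⟨e, i⟩ | ⟨e, i⟩ <;> rw [e] <;> linarith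

/-- the midpoint of the third side is far from the two other sides -/
lemma far_mR {a b c t : ℝ} (ha : 1 ≤ a) (hb : 3 * a + 1 ≤ b) (hbc : 2 * b ≤ c) (h0 : 0 ≤ t)
    (h : t ≤ (b - a) + (c - b - a) / 2) :
    (c - b + 3 * a) / 4 ≤ mR a c (b - a) (c - a) (c - a - (c - b - a) / 4) t := by
  refine le_mR ?_ ?_ ?_
  · rcases nuR_split c (c - a - (c - b - a) / 4) t with ⟨e, i⟩ | ⟨e, i⟩ | ⟨e, i⟩ | ⟨e, i⟩ <;> rw [e] <;>
      linarith
  · rcases nuR_split c (c - a - (c - b - a) / 4) (b - a) with ⟨e, i⟩ | ⟨e, i⟩ | ⟨e, i⟩ | ⟨e, i⟩ <;> rw [e] <;>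
    rcases nuR_split c t (c - a) with ⟨e, i⟩ | ⟨e, i⟩ | ⟨e, i⟩ | ⟨e, i⟩ <;> rw [e] <;> linarith
  · rcases nuR_split c (c - a - (c - b - a) / 4) (c - a) with ⟨e, i⟩ | ⟨e, i⟩ | ⟨e, i⟩ | ⟨e, i⟩ <;> rw [e] <;>
    rcases nuR_split c t (b - a) with ⟨e, i⟩ | ⟨e, i⟩ | ⟨e, i⟩ | ⟨e, i⟩ <;> rw [e] <;> linarith

end lower


section lower

lemma mR_wrap (a c U W s t : ℝ) : mR a c U W s t ≤ |s - t| ∧ mR a c U W s t ≤ c - |s - t| := by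
  have h : mR a c U W s t ≤ nuR c s t := min_le_left _ _
  exact ⟨h.trans (min_le_left _ _), h.trans (min_le_right _ _)⟩

lemma theta_lower {a b c n : ℕ} (ha : 1 ≤ a) (hn : n + 1 = c + a) (hb : 3 * a + 1 ≤ b)
    (hbc : 2 * b ≤ c) :
    ∃ T : MGTriangle (thetaG b c n), ((c : ℝ) - b + 3 * a) / 4 ≤ triangleDelta T := by
  have hG : (thetaG b c n).Connected := thetaG_connected (by omega)
  have hz := theta_cycF_c (b := b) (c := c) (n := n) (by omega) (by omega) (a - 1)
  have hge : ∀ s t : ℝ, 0 ≤ s → 0 ≤ t → s ≤ c → t ≤ c →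
      mR a c (b - a) (c - a) s t ≤ mgDist _ (cycPt hz s) (cycPt hz t) := by
    intro s t h1 h2 h3 h4
    exact cycPt_ge hG hz (mR a c (b - a) (c - a)) (fun s t i j => mR_lip _ _ _ _ s t i j)
      (fun s t => mR_wrap _ _ _ _ s t)
      (fun i j hi hj => theta_dist_pos ha hn hb hbc _ _ i j hi hj rfl rfl) h1 h2 h3 h4
  have ha' : (1 : ℝ) ≤ a := by exact_mod_cast ha
  have hb' : (3 : ℝ) * a + 1 ≤ b := by exact_mod_cast hb
  have hbc' : (2 : ℝ) * b ≤ c := by exact_mod_cast hbc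
  have hgeo : ∀ x y : ℝ, 0 ≤ x → x ≤ y → y ≤ c →
      (y ≤ ((b : ℝ) - a) / 2 ∨ (((b : ℝ) - a) / 2 ≤ x ∧ y ≤ ((b : ℝ) - a) + (c - b - a) / 2) ∨
      ((b : ℝ) - a) + (c - b - a) / 2 ≤ x) → IsMGGeodesic _ x y (cycPt hz) := by
    intro x y hx hxy hy h
    have key : ∀ s t : ℝ, x ≤ s → s ≤ t → t ≤ y →
        mgDist _ (cycPt hz s) (cycPt hz t) = |s - t| := by
      intro s t h1 h2 h3
      refine le_antisymm (cycPt_le hG hz (by linarith) (by linarith)) ?_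
      have e := hge s t (by linarith) (by linarith) (by linarith) (by linarith)
      have e2 := side_mR (s := s) (t := t) ha' hb' hbc' (by linarith) h2 (by linarith) (by
        rcases h with h | ⟨h, h'⟩ | h
        · left; linarith
        · right; left; constructor <;> linarith
        · right; right; linarith)
      rw [abs_sub_comm, abs_of_nonneg (by linarith)]
      linarith
    refine ⟨hxy, fun s hs t ht => ?_⟩
    rcases le_total s t with h' | h'
    · exact key s t hs.1 h' ht.2
    · rw [mgDist_comm, abs_sub_comm]; exact key t s ht.1 h' hs.2
  have hself : ∀ s : ℝ, 0 ≤ s → mgDist _ (cycPt hz s) (cycPt hz s) = 0 := by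
    intro s hs
    refine le_antisymm ?_ (mgDist_nonneg hG _ _)
    have := cycPt_le hG hz hs hs
    simpa using this
  have hclose : mgDist _ (cycPt hz (c : ℝ)) (cycPt hz 0) = 0 := by
    refine le_antisymm ?_ (mgDist_nonneg hG _ _)
    have p0 := hz.per 0
    have p1 := hz.per 1
    rw [zero_add] at p0
    rw [add_comm 1 c] at p1
    have := mgDist_le_same (cycPt hz (c : ℝ)) (cycPt hz 0)
      (by simp only [cycPt, Nat.floor_natCast, Nat.floor_zero]; exact p0)
      (by simp only [cycPt, Nat.floor_natCast, Nat.floor_zero]; exact p1)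
    simpa [cycPt] using this
  let T : MGTriangle (thetaG b c n) :=
    { a1 := 0, b1 := ((b : ℝ) - a) / 2, a2 := ((b : ℝ) - a) / 2
      b2 := ((b : ℝ) - a) + (c - b - a) / 2, a3 := ((b : ℝ) - a) + (c - b - a) / 2, b3 := c
      g1 := cycPt hz, g2 := cycPt hz, g3 := cycPt hz
      h1 := hgeo _ _ le_rfl (by linarith) (by linarith) (Or.inl le_rfl)
      h2 := hgeo _ _ (by linarith) (by linarith) (by linarith) (Or.inr (Or.inl ⟨le_rfl, le_rfl⟩))
      h3 := hgeo _ _ (by linarith) (by linarith) le_rfl (Or.inr (Or.inr le_rfl))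
      glue1 := hself _ (by linarith)
      glue2 := hself _ (by linarith)
      glue3 := hclose }
  refine ⟨T, le_csInf ⟨(Fintype.card (Fin n) : ℝ), by positivity, ?_, ?_, ?_⟩ ?_⟩
  · exact fun s _ => Or.inl ⟨_, ⟨le_rfl, T.h2.1⟩, mgDist_le_card hG _ _⟩
  · exact fun s _ => Or.inl ⟨_, ⟨le_rfl, T.h1.1⟩, mgDist_le_card hG _ _⟩
  · exact fun s _ => Or.inl ⟨_, ⟨le_rfl, T.h1.1⟩, mgDist_le_card hG _ _⟩
  · rintro d ⟨_, _, _, h⟩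
    have main : ∀ t : ℝ, 0 ≤ t → t ≤ ((b : ℝ) - a) + (c - b - a) / 2 →
        mgDist _ (cycPt hz ((c : ℝ) - a - (c - b - a) / 4)) (cycPt hz t) ≤ d →
        ((c : ℝ) - b + 3 * a) / 4 ≤ d := by
      intro t h0 h1 h2
      have e := hge ((c : ℝ) - a - (c - b - a) / 4) t (by linarith) h0 (by linarith) (by linarith)
      have e2 := far_mR ha' hb' hbc' h0 h1
      linarith
    rcases h ((c : ℝ) - a - (c - b - a) / 4)
      ⟨by change ((b : ℝ) - a) + (c - b - a) / 2 ≤ _; linarith,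
       by change _ ≤ (c : ℝ); linarith⟩ with ⟨t, ⟨t1, t2⟩, ht⟩ | ⟨t, ⟨t1, t2⟩, ht⟩
    · change (0 : ℝ) ≤ t at t1
      change t ≤ ((b : ℝ) - a) / 2 at t2
      exact main t t1 (by linarith) ht
    · change ((b : ℝ) - a) / 2 ≤ t at t1
      change t ≤ ((b : ℝ) - a) + (c - b - a) / 2 at t2
      exact main t (by linarith) t2 ht

end lower

/-- Lemma (t2): If `(g,c,n)` is v-admissible, `g < c` and `n < c - 1 + g/4`, then
`B(g,c,n) = n + 1 - (g + 3c)/4`. -/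
theorem Bgcn_eq_of_small (g c n : ℕ) (h3 : 3 ≤ g) (hgc : g < c) (hcn : c ≤ n)
    (hadm : ∃ G : SimpleGraph (Fin n), memGclass g c G)
    (hyp : (n : ℝ) < (c : ℝ) - 1 + (g : ℝ) / 4) :
    Bgcn g c n = (n : ℝ) + 1 - ((g : ℝ) + 3 * (c : ℝ)) / 4 := by
  obtain ⟨a, hn⟩ : ∃ a, n + 1 = c + a := ⟨n + 1 - c, by omega⟩
  have ha : 1 ≤ a := by omega
  have hnR : (n : ℝ) + 1 = c + a := by exact_mod_cast hn
  have hag : 4 * a < g := by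
    have : (4 : ℝ) * a < g := by linarith
    exact_mod_cast this
  have hcard : Fintype.card (Fin n) + 1 = c + a := by simpa using hn
  have hgcR : (g : ℝ) < c := by exact_mod_cast hgc
  have h2g : 2 * g ≤ c + 2 * a := by
    obtain ⟨G, _, h1, h2⟩ := hadm
    exact adm_ineq h1 h2 h3 hgc ha hcard hag
  obtain ⟨b, hb⟩ : ∃ b, a + b = g := ⟨g - a, by omega⟩
  have hb3 : 3 * a + 1 ≤ b := by omega
  have hbc : 2 * b ≤ c := by omega
  have hbR : (a : ℝ) + b = g := by exact_mod_cast hb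
  have haR : (0 : ℝ) ≤ a := Nat.cast_nonneg a
  have hD : (n : ℝ) + 1 - ((g : ℝ) + 3 * (c : ℝ)) / 4 = ((c : ℝ) - g + 4 * a) / 4 := by linarith
  have hup : ∀ d ∈ {d : ℝ | ∃ G : SimpleGraph (Fin n), memGclass g c G ∧ d = hypDelta G},
      d ≤ ((c : ℝ) - g + 4 * a) / 4 := by
    rintro d ⟨G, ⟨hG, h1, h2⟩, rfl⟩
    exact upper_hyp hG h1 h2 h3 hgc ha hcard hag
  rw [hD]
  refine le_antisymm (Real.sSup_le hup (by linarith)) ?_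
  have hG : (thetaG b c n).Connected := thetaG_connected (by omega)
  have hgi : (thetaG b c n).girth = g := by rw [theta_girth ha hn hb3 hbc, hb]
  have hci : circumference (thetaG b c n) = c := theta_circ ha hn hb3 hbc
  obtain ⟨T, hT⟩ := theta_lower ha hn hb3 hbc
  have e1 : triangleDelta T ≤ hypDelta (thetaG b c n) := by
    refine le_csSup ⟨((c : ℝ) - g + 4 * a) / 4, ?_⟩ ⟨T, rfl⟩
    rintro d ⟨T', rfl⟩
    exact upper_triangle hG hgi hci h3 hgc ha hcard hag T'
  have e2 : hypDelta (thetaG b c n) ≤ Bgcn g c n :=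
    le_csSup ⟨_, hup⟩ ⟨_, ⟨hG, hgi, hci⟩, rfl⟩
  linarith
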